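/- arXiv:1407.3200 — 4 statements merged into one kernel-verified Lean document; each statement's English description precedes it below -/
import Mathlib

section
/- There exist constants c > 0, C > 0 and N_0 such that for all integers N, M with N_0 ≤ N ≤ M ≤ N², there exists a finite connected undirected graph with at least N and at most C·N vertices and at least M and at most C·M edges, together with an initial rotor-router state carrying exactly 2 tokens, whose stabilization time is at least c·M²·log N. -/
open Finset

namespace RotorRouter

variable {V : Type} [Fintype V] [DecidableEq V] (G : SimpleGraph V) [DecidableRel G.Adj]

/-- The outgoing arcs (darts) of a vertex `v`. -/
def outArcs (v : V) : Finset G.Dart := Finset.univ.filter (fun d => d.fst = v)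

/-- The incoming arcs (darts) of a vertex `v`. -/
def inArcs (v : V) : Finset G.Dart := Finset.univ.filter (fun d => d.snd = v)

/-- A state of the rotor-router system: at each vertex, the current pointer
(represented as an index, in the fixed cyclic order, of an outgoing arc) and the
number of tokens currently located at the vertex. -/
structure State where
  ptr : V → ℕ
  tokens : V → ℕ
  ptr_lt : ∀ v : V, 0 < G.degree v → ptr v < G.degree v

variable (ord : ∀ v : V, Fin (G.degree v) ≃ {d : G.Dart // d.fst = v})

/-- The number of tokens sent out on the `j`-th outgoing arc when `k` tokens leave a
vertex of degree `deg` in round-robin fashion, starting from pointer position `p`. -/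
def sentCount (deg p k j : ℕ) : ℕ :=
  ((Finset.range k).filter (fun i => (p + i) % deg = j)).card

/-- The number of tokens sent along the arc `d` during one step from state `S`. -/
def arcLoad (S : State G) (d : G.Dart) : ℕ :=
  sentCount (G.degree d.fst) (S.ptr d.fst) (S.tokens d.fst)
    (((ord d.fst).symm ⟨d, rfl⟩ : Fin (G.degree d.fst)) : ℕ)

/-- One synchronous step of the rotor-router system: every vertex sends out all of its
tokens in round-robin fashion, advancing its pointer after each token. -/
def step (S : State G) : State G where
  ptr v := if 0 < G.degree v then (S.ptr v + S.tokens v) % G.degree v else S.ptr v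
  tokens v := (∑ d ∈ inArcs G v, arcLoad G ord S d) +
    (if 0 < G.degree v then 0 else S.tokens v)
  ptr_lt v h := by simp only [if_pos h]; exact Nat.mod_lt _ h

/-- `evol S0 t` is the state `S_t` reached after `t` steps from the initial state `S0`. -/
def evol (S0 : State G) (t : ℕ) : State G := (step G ord)^[t] S0

/-- `load S0 t d` is `L_t(d)`, the number of tokens sent along arc `d` during step `t`. -/
def load (S0 : State G) (t : ℕ) (d : G.Dart) : ℕ := arcLoad G ord (evol G ord S0 t) d

/-- `cum S0 t1 t2 d` is the cumulative load `C_{t1}^{t2}(d) = Σ_{t1 ≤ t < t2} L_t(d)`. -/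
def cum (S0 : State G) (t1 t2 : ℕ) (d : G.Dart) : ℕ :=
  ∑ t ∈ Finset.Ico t1 t2, load G ord S0 t d

/-- `cumV S0 t1 t2 v` is the cumulative vertex load `C_{t1}^{t2}(v)`. -/
def cumV (S0 : State G) (t1 t2 : ℕ) (v : V) : ℕ :=
  ∑ t ∈ Finset.Ico t1 t2, (evol G ord S0 t).tokens v

/-- `pot S0 i t` is the `i`-th potential `Φ_i(S_t) = Σ_{e} (C_t^{t+i}(e))²`. -/
def pot (S0 : State G) (i t : ℕ) : ℕ := ∑ d : G.Dart, (cum G ord S0 t (t + i) d) ^ 2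

/-- A state `S_t` is stable if it repeats: `S_{t'} = S_t` for some `t' > t`. -/
def IsStable (S0 : State G) (t : ℕ) : Prop :=
  ∃ t' > t, evol G ord S0 t' = evol G ord S0 t

/-- A family of bijections `in(v) → out(v)` (encoded as a global bijection `M` on darts
with `(M d).fst = d.snd`) is valid w.r.t. the `Δt`-step subcycle decomposition of `S_T`
if `L_t(e) = L_{t+1}(M e)` for all arcs `e` and all `T ≤ t < T + Δt`. -/
def ValidMapping (S0 : State G) (T Δt : ℕ) (M : G.Dart → G.Dart) : Prop :=
  Function.Bijective M ∧ (∀ d : G.Dart, (M d).fst = d.snd) ∧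
    ∀ (d : G.Dart) (t : ℕ), T ≤ t → t < T + Δt →
      load G ord S0 t d = load G ord S0 (t + 1) (M d)

/-- `S_T` admits a `Δt`-step subcycle decomposition. -/
def HasSubcycleDecomp (S0 : State G) (T Δt : ℕ) : Prop :=
  ∃ M : G.Dart → G.Dart, ValidMapping G ord S0 T Δt M


/-- A rotor-router system: a finite connected undirected graph together with a fixed
cyclic ordering of the outgoing arcs at every vertex. -/
structure System where
  V : Type
  [fin : Fintype V]
  [deq : DecidableEq V]
  G : SimpleGraph V
  [adj : DecidableRel G.Adj]
  conn : G.Connected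
  ord : ∀ v : V, Fin (G.degree v) ≃ {d : G.Dart // d.fst = v}

attribute [instance] System.fin System.deq System.adj

/-- The stabilization time of `S0`: the least `t` such that `S_t` is stable. -/
noncomputable def stabTime (S0 : State G) : ℕ := sInf {t : ℕ | IsStable G ord S0 t}

/-- The periodicity of `S0`: the least `t_p > 0` with `S_{t_s + t_p} = S_{t_s}`. -/
noncomputable def period (S0 : State G) : ℕ :=
  sInf {p : ℕ | 0 < p ∧
    evol G ord S0 (stabTime G ord S0 + p) = evol G ord S0 (stabTime G ord S0)}

section EulerTour

set_option linter.unusedSectionVars false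

/-- An Eulerian circuit of the symmetric directed version of `G`, written as a periodic
sequence of vertices. -/
structure EulerTour where
  len : ℕ
  w : ℕ → V
  len_pos : 0 < len
  periodic : ∀ t, w (t + len) = w t
  adj : ∀ t, G.Adj (w t) (w (t + 1))
  inj : ∀ s < len, ∀ t < len, w s = w t → w (s + 1) = w (t + 1) → s = t
  surj : ∀ d : G.Dart, ∃ t < len, w t = d.fst ∧ w (t + 1) = d.snd

namespace EulerTour

variable {G} (T : EulerTour G)

/-- The arc traversed by the tour at time `t`. -/
def dartAt (t : ℕ) : G.Dart := ⟨(T.w t, T.w (t + 1)), T.adj t⟩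

/-- The number of visits of the tour to `v` before time `t`. -/
def visits (v : V) (t : ℕ) : ℕ := Nat.count (fun s => T.w s = v) t

theorem visits_succ (v : V) (t : ℕ) :
    T.visits v (t + 1) = T.visits v t + if T.w t = v then 1 else 0 := Nat.count_succ _ _

theorem visits_eq_of_forall_ne (v : V) {s t : ℕ} (hst : s ≤ t)
    (h : ∀ r, s ≤ r → r < t → T.w r ≠ v) : T.visits v t = T.visits v s := by
  induction t, hst using Nat.le_induction with
  | base => rfl
  | succ t hst ih =>
    rw [visits_succ, if_neg (h t hst (Nat.lt_succ_self t)), add_zero,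
      ih fun r hr hrt => h r hr (hrt.trans (Nat.lt_succ_self t))]

theorem exists_dartAt_eq (d : G.Dart) : ∃ t < T.len, T.dartAt t = d := by
  obtain ⟨t, ht, h1, h2⟩ := T.surj d
  exact ⟨t, ht, SimpleGraph.Dart.ext _ _ (Prod.ext h1 h2)⟩

theorem dartAt_injOn {s t : ℕ} (hs : s < T.len) (ht : t < T.len)
    (h : T.dartAt s = T.dartAt t) : s = t :=
  T.inj s hs t ht (congrArg (fun d : G.Dart => d.fst) h) (congrArg (fun d : G.Dart => d.snd) h)

theorem dartAt_add_len (t : ℕ) : T.dartAt (t + T.len) = T.dartAt t := by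
  refine SimpleGraph.Dart.ext _ _ (Prod.ext (T.periodic t) ?_)
  show T.w (t + T.len + 1) = T.w (t + 1)
  rw [add_right_comm, T.periodic]

theorem card_dart : Fintype.card G.Dart = T.len := by
  rw [← Finset.card_univ, ← Finset.card_range T.len]
  symm
  refine Finset.card_bij (fun t _ => T.dartAt t) (fun _ _ => Finset.mem_univ _) ?_ ?_
  · intro s hs t ht h
    exact T.dartAt_injOn (Finset.mem_range.1 hs) (Finset.mem_range.1 ht) h
  · intro d _
    obtain ⟨t, ht, h⟩ := T.exists_dartAt_eq d
    exact ⟨t, Finset.mem_range.2 ht, h⟩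

theorem visits_len (v : V) : T.visits v T.len = G.degree v := by
  rw [visits, Nat.count_eq_card_filter_range, ← G.dart_fst_fiber_card_eq_degree v]
  refine Finset.card_bij (fun t _ => T.dartAt t) ?_ ?_ ?_
  · intro t ht
    exact Finset.mem_filter.2 ⟨Finset.mem_univ _, (Finset.mem_filter.1 ht).2⟩
  · intro s hs t ht h
    exact T.dartAt_injOn (Finset.mem_range.1 (Finset.mem_filter.1 hs).1)
      (Finset.mem_range.1 (Finset.mem_filter.1 ht).1) h
  · intro d hd
    obtain ⟨t, ht, h⟩ := T.exists_dartAt_eq d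
    refine ⟨t, Finset.mem_filter.2 ⟨Finset.mem_range.2 ht, ?_⟩, h⟩
    rw [← (Finset.mem_filter.1 hd).2, ← h]
    rfl

theorem visits_add_len (v : V) (t : ℕ) : T.visits v (t + T.len) = T.visits v t + G.degree v := by
  rw [← T.visits_len v, visits, Nat.count_add']
  simp only [T.periodic]
  rfl

theorem visits_lt_degree {t : ℕ} (ht : t < T.len) : T.visits (T.w t) t < G.degree (T.w t) := by
  rw [← T.visits_len]
  exact Nat.count_strict_mono (p := fun s => T.w s = T.w t) rfl ht

theorem visits_mod_add_len (v : V) (t : ℕ) :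
    T.visits v (t + T.len) % G.degree v = T.visits v t % G.degree v := by
  rw [visits_add_len, Nat.add_mod_right]

theorem visits_mod_len (v : V) (t : ℕ) :
    T.visits v (t % T.len) % G.degree v = T.visits v t % G.degree v := by
  conv_rhs => rw [← Nat.mod_add_div t T.len]
  induction t / T.len with
  | zero => simp
  | succ q ih => rw [ih, Nat.mul_succ, ← add_assoc, visits_mod_add_len]

theorem dartAt_mod_len (t : ℕ) : T.dartAt (t % T.len) = T.dartAt t := by
  conv_rhs => rw [← Nat.mod_add_div t T.len]
  induction t / T.len with
  | zero => simp
  | succ q ih => rw [ih, Nat.mul_succ, ← add_assoc, dartAt_add_len]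

end EulerTour

variable {G}

/-- The index of an arc in the cyclic order at its source. -/
def arcIndex (d : G.Dart) : ℕ := ((ord d.fst).symm ⟨d, rfl⟩ : Fin (G.degree d.fst))

variable {ord}

theorem arcIndex_injective {d d' : G.Dart} (h : d.fst = d'.fst)
    (hi : arcIndex ord d = arcIndex ord d') : d = d' := by
  have key : ∀ (v : V) (h : d.fst = v) (h' : d'.fst = v),
      (((ord v).symm ⟨d, h⟩ : Fin _) : ℕ) = ((ord v).symm ⟨d', h'⟩ : Fin _) → d = d' := by
    intro v h h' e
    exact congrArg Subtype.val ((ord v).symm.injective (Fin.ext e))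
  refine key _ rfl h.symm ?_
  have transport : ∀ (v : V) (h' : d'.fst = v),
      (((ord v).symm ⟨d', h'⟩ : Fin _) : ℕ) = arcIndex ord d' := by
    rintro _ rfl
    rfl
  rw [transport]
  exact hi

variable (ord) in
/-- The rotor orders follow the tour: the arcs leaving a vertex are ordered by the time at
which the tour uses them. -/
def EulerTour.Follows (T : EulerTour G) : Prop :=
  ∀ t, arcIndex ord (T.dartAt t) = T.visits (T.w t) t % G.degree (T.w t)

theorem EulerTour.exists_follows (T : EulerTour G) :
    ∃ ord : ∀ v : V, Fin (G.degree v) ≃ {d : G.Dart // d.fst = v}, T.Follows ord := by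
  choose time htime hdart using T.exists_dartAt_eq
  have hw : ∀ d, T.w (time d) = d.fst := fun d =>
    congrArg (fun d : G.Dart => d.fst) (hdart d)
  have hlt : ∀ v (d : {d : G.Dart // d.fst = v}), T.visits v (time d) < G.degree v := by
    rintro _ ⟨d, rfl⟩
    have := T.visits_lt_degree (htime d)
    rwa [hw d] at this
  let f : ∀ v, {d : G.Dart // d.fst = v} → Fin (G.degree v) := fun v d =>
    ⟨T.visits v (time d), hlt v d⟩
  have hf : ∀ v, Function.Bijective (f v) := by
    intro v
    rw [Fintype.bijective_iff_injective_and_card]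
    constructor
    · rintro ⟨d, hd⟩ ⟨d', hd'⟩ h
      have h : T.visits v (time d) = T.visits v (time d') := congrArg Fin.val h
      have := Nat.count_injective (p := fun s => T.w s = v) ((hw d).trans hd)
        ((hw d').trans hd') h
      exact Subtype.ext (show d = d' by rw [← hdart d, this, hdart d'])
    · rw [Fintype.card_fin, ← G.dart_fst_fiber_card_eq_degree v, Fintype.card_subtype]
  refine ⟨fun v => (Equiv.ofBijective (f v) (hf v)).symm, fun t => ?_⟩
  have h1 : arcIndex (fun v => (Equiv.ofBijective (f v) (hf v)).symm) (T.dartAt t)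
      = T.visits (T.w t) (time (T.dartAt t)) := rfl
  have h2 : time (T.dartAt t) = t % T.len :=
    T.dartAt_injOn (htime _) (Nat.mod_lt _ T.len_pos)
      ((hdart _).trans (T.dartAt_mod_len t).symm)
  have h3 : T.w (t % T.len) = T.w t :=
    congrArg (fun d : G.Dart => d.fst) (T.dartAt_mod_len t)
  have h4 := T.visits_lt_degree (Nat.mod_lt t T.len_pos)
  rw [h3] at h4
  rw [h1, h2, ← T.visits_mod_len, Nat.mod_eq_of_lt h4]

theorem sentCount_zero (deg p j : ℕ) : sentCount deg p 0 j = 0 := rfl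

theorem sentCount_succ (deg p k j : ℕ) :
    sentCount deg p (k + 1) j = sentCount deg p k j + if (p + k) % deg = j then 1 else 0 := by
  unfold sentCount
  rw [Finset.card_filter, Finset.card_filter, Finset.sum_range_succ]

/-- One step of a system with two tokens which are about to leave along the arcs `d₁`, `d₂`. -/
theorem step_eq_of_two_tokens {S S' : State G} {d₁ d₂ : G.Dart}
    (htok : ∀ v, S.tokens v = (if d₁.fst = v then 1 else 0) + if d₂.fst = v then 1 else 0)
    {c : ℕ} (hc : c ≤ 1)
    (h₁ : (S.ptr d₁.fst + if d₁.fst = d₂.fst then c else 0) % G.degree d₁.fst = arcIndex ord d₁)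
    (h₂ : (S.ptr d₂.fst + if d₁.fst = d₂.fst then 1 - c else 0) % G.degree d₂.fst =
      arcIndex ord d₂)
    (hptr' : ∀ v, S'.ptr v % G.degree v = (S.ptr v + S.tokens v) % G.degree v)
    (htok' : ∀ v, S'.tokens v = (if d₁.snd = v then 1 else 0) + if d₂.snd = v then 1 else 0)
    (hdeg : ∀ v, 0 < G.degree v) : step G ord S = S' := by
  have hload : ∀ d : G.Dart,
      arcLoad G ord S d = (if d = d₁ then 1 else 0) + if d = d₂ then 1 else 0 := by
    intro d
    have hd : ∀ d' : G.Dart, d = d' ↔ d'.fst = d.fst ∧ arcIndex ord d' = arcIndex ord d :=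
      fun d' => ⟨by rintro rfl; simp, fun h => (arcIndex_injective h.1 h.2).symm⟩
    have hcalc : arcLoad G ord S d =
        sentCount (G.degree d.fst) (S.ptr d.fst) (S.tokens d.fst) (arcIndex ord d) := rfl
    rw [hcalc, htok]
    by_cases e₁ : d₁.fst = d.fst <;> by_cases e₂ : d₂.fst = d.fst
    · rw [e₁, e₂, if_pos rfl] at h₁ h₂
      obtain rfl | rfl := Nat.le_one_iff_eq_zero_or_eq_one.1 hc
      · simp [hd, e₁, e₂, ← h₁, ← h₂, sentCount_succ, sentCount_zero]
      · simp [hd, e₁, e₂, ← h₁, ← h₂, sentCount_succ, sentCount_zero, add_comm]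
    · rw [e₁, if_neg (Ne.symm e₂)] at h₁
      simp [hd, e₁, e₂, ← h₁, sentCount_succ, sentCount_zero]
    · rw [e₂, if_neg e₁] at h₂
      simp [hd, e₁, e₂, ← h₂, sentCount_succ, sentCount_zero]
    · simp [hd, e₁, e₂, sentCount_zero]
  have hp : (step G ord S).ptr = S'.ptr := by
    funext v
    rw [← Nat.mod_eq_of_lt (S'.ptr_lt v (hdeg v)), hptr' v]
    exact if_pos (hdeg v)
  have ht : (step G ord S).tokens = S'.tokens := by
    funext v
    have : (step G ord S).tokens v = (∑ d ∈ inArcs G v, arcLoad G ord S d) + 0 := by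
      show _ + (if 0 < G.degree v then 0 else S.tokens v) = _
      rw [if_pos (hdeg v)]
    rw [this, htok', add_zero]
    simp only [hload, inArcs, Finset.sum_add_distrib, Finset.sum_ite_eq', Finset.mem_filter,
      Finset.mem_univ, true_and]
  cases S'
  cases hp
  cases ht
  rfl

end EulerTour

section Config

/-- A configuration of two tokens shuttling on either side of a border vertex `i` of a path:
the left token returns to the border in `x` steps, the right one in `y` steps, and `right`
records whether the rotor of the border vertex points to the right. -/
structure Config where
  i : ℕ
  x : ℕ
  y : ℕ
  right : Bool

namespace Config

/-- The successor of a configuration.  The round trips of the tokens have lengths `e + 2 * i`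
and `e + 4 * N + 4 - 2 * i`; a left token finding the rotor pointing to the right pushes the
border by one. -/
def next (e N : ℕ) (z : Config) : Config :=
  if z.x = 0 then
    if z.y = 0 then ⟨z.i, e + 2 * z.i - 1, e + 4 * N + 3 - 2 * z.i, z.right⟩
    else if z.right then ⟨z.i + 1, 0, z.y - 2, false⟩
    else ⟨z.i, e + 2 * z.i - 1, z.y - 1, true⟩
  else if z.y = 0 then ⟨z.i, z.x - 1, e + 4 * N + 3 - 2 * z.i, false⟩
  else ⟨z.i, z.x - 1, z.y - 1, z.right⟩

/-- The configurations reached from the initial one. -/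
structure Valid (e N : ℕ) (z : Config) : Prop where
  one_le : 1 ≤ z.i
  le : z.i ≤ N + 1
  x_lt : z.x < e + 2 * z.i
  y_lt : z.y + 2 * z.i < e + 4 * N + 4
  parity : z.x % 2 = z.y % 2
  of_left : z.right = false → z.x ≤ z.y
  of_right : z.right = true → z.y + 4 * z.i ≤ z.x + (4 * N + 4)

variable {e N : ℕ} {z : Config}

theorem next_cases (z : Config) (hz : z.Valid e N) :
    (0 < z.x ∧ 0 < z.y ∧ z.next e N = ⟨z.i, z.x - 1, z.y - 1, z.right⟩) ∨
    (z.x = 0 ∧ 0 < z.y ∧ z.right = false ∧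
      z.next e N = ⟨z.i, e + 2 * z.i - 1, z.y - 1, true⟩) ∨
    (0 < z.x ∧ z.y = 0 ∧ z.right = true ∧
      z.next e N = ⟨z.i, z.x - 1, e + 4 * N + 3 - 2 * z.i, false⟩) ∨
    (z.x = 0 ∧ z.y = 0 ∧
      z.next e N = ⟨z.i, e + 2 * z.i - 1, e + 4 * N + 3 - 2 * z.i, z.right⟩) ∨
    (z.x = 0 ∧ 2 ≤ z.y ∧ z.right = true ∧ z.i ≤ N ∧ z.next e N = ⟨z.i + 1, 0, z.y - 2, false⟩) := by
  obtain ⟨h1, h2, h3, h4, h5, h6, h7⟩ := hz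
  by_cases hx : z.x = 0 <;> by_cases hy : z.y = 0
  · exact Or.inr (Or.inr (Or.inr (Or.inl ⟨hx, hy, by simp [next, hx, hy]⟩)))
  · cases hp : z.right
    · exact Or.inr (Or.inl ⟨hx, by omega, rfl, by simp [next, hx, hy, hp]⟩)
    · have := h7 hp
      exact Or.inr (Or.inr (Or.inr (Or.inr
        ⟨hx, by omega, rfl, by omega, by simp [next, hx, hy, hp]⟩)))
  · have hp : z.right = true := by
      by_contra hp
      have := h6 (by simpa using hp)
      omega
    exact Or.inr (Or.inr (Or.inl ⟨by omega, hy, hp, by simp [next, hx, hy]⟩))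
  · exact Or.inl ⟨by omega, by omega, by simp [next, hx, hy]⟩

theorem Valid.next (he : e % 2 = 0) (he0 : 0 < e) (hz : z.Valid e N) : (z.next e N).Valid e N := by
  have hc := z.next_cases hz
  obtain ⟨h1, h2, h3, h4, h5, h6, h7⟩ := hz
  rcases hc with ⟨hx, hy, h⟩ | ⟨hx, hy, hp, h⟩ | ⟨hx, hy, hp, h⟩ | ⟨hx, hy, h⟩ |
    ⟨hx, hy, hp, hi, h⟩ <;> rw [h] <;> refine ⟨?_, ?_, ?_, ?_, ?_, fun hp' => ?_, fun hp' => ?_⟩ <;>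
    simp only [Bool.false_eq_true, reduceCtorEq] at * <;>
    first | omega | (have := h6 hp'; omega) | (have := h7 hp'; omega)

/-- The configuration with both tokens at the first vertex of the path. -/
def init : Config := ⟨1, 0, 0, false⟩

theorem valid_init : init.Valid e N := by
  constructor <;> simp [init]

theorem valid_iterate (he : e % 2 = 0) (he0 : 0 < e) (hz : z.Valid e N) (t : ℕ) :
    ((next e N)^[t] z).Valid e N := by
  induction t with
  | zero => exact hz
  | succ t ih => rw [Function.iterate_succ_apply']; exact ih.next he he0

theorem i_le_next (hz : z.Valid e N) : z.i ≤ (z.next e N).i := by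
  rcases z.next_cases hz with ⟨hx, hy, h⟩ | ⟨hx, hy, hp, h⟩ | ⟨hx, hy, hp, h⟩ | ⟨hx, hy, h⟩ |
    ⟨hx, hy, hp, hi, h⟩ <;> simp [h]

theorem next_eq_of_i_ne (hz : z.Valid e N) (h : (z.next e N).i ≠ z.i) :
    z.x = 0 ∧ 2 ≤ z.y ∧ z.right = true ∧ z.next e N = ⟨z.i + 1, 0, z.y - 2, false⟩ := by
  rcases z.next_cases hz with ⟨hx, hy, h'⟩ | ⟨hx, hy, hp, h'⟩ | ⟨hx, hy, hp, h'⟩ | ⟨hx, hy, h'⟩ |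
    ⟨hx, hy, hp, hi, h'⟩ <;> simp_all

theorem i_mono (he : e % 2 = 0) (he0 : 0 < e) (hz : z.Valid e N) :
    Monotone fun t => ((next e N)^[t] z).i := by
  refine monotone_nat_of_le_succ fun t => ?_
  rw [Function.iterate_succ_apply']
  exact i_le_next (valid_iterate he he0 hz t)

/-- If the right token arrives first, then it gets to the border without moving it. -/
theorem exists_iterate_y_eq_zero_of_le (h : z.y ≤ z.x) :
    ∃ s, ((next e N)^[s] z).i = z.i ∧ ((next e N)^[s] z).y = 0 := by
  obtain ⟨i, x, y, p⟩ := z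
  induction y generalizing x with
  | zero => exact ⟨0, rfl, rfl⟩
  | succ y ih =>
    simp only at h
    obtain ⟨s, hs⟩ := ih (x - 1) (by simp only; omega)
    refine ⟨s + 1, ?_⟩
    have : next e N ⟨i, x, y + 1, p⟩ = ⟨i, x - 1, y, p⟩ := by
      simp [next, show x ≠ 0 by omega]
    rw [Function.iterate_succ_apply, this]
    exact hs

end Config

end Config

section LeveledTour

set_option linter.unusedSectionVars false

/-- An Eulerian circuit of a graph made of two blobs joined by a path with `2 * N + 2` edges:
it makes a tour of length `e` in the first blob, walks along the path, makes a tour of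
length `e` in the second blob and walks back. -/
structure LeveledTour (e N : ℕ) extends EulerTour G where
  lev : V → ℕ
  len_eq : len = 2 * e + 4 * N + 4
  lev_w : ∀ t ≤ len, lev (w t) = min (t - e) (min (2 * N + 2) (len - t))
  lev_inj : ∀ u v, 0 < lev u → lev u < 2 * N + 2 → lev u = lev v → u = v
  degree_pos : ∀ v, 0 < G.degree v

namespace LeveledTour

variable {G} {e N : ℕ} (T : LeveledTour G e N)

theorem lev_w_add_len {t : ℕ} (ht : t ≤ T.len) :
    T.lev (T.w (T.len + t)) = min (t - e) (min (2 * N + 2) (T.len - t)) := by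
  rw [add_comm, T.periodic, T.lev_w t ht]

theorem lev_lt {i t : ℕ} (hi : 1 ≤ i) (hi' : i ≤ N + 1) (h₁ : T.len < t + i)
    (h₂ : t < T.len + e + i) : T.lev (T.w t) < i := by
  have := T.len_eq
  rcases le_total t T.len with h | h
  · rw [T.lev_w t h]
    omega
  · obtain ⟨s, rfl⟩ := Nat.exists_eq_add_of_le h
    rw [T.lev_w_add_len (by omega)]
    omega

theorem lt_lev {i t : ℕ} (hi : 1 ≤ i) (hi' : i ≤ N + 1) (h₁ : e + i < t)
    (h₂ : t + i < T.len) : i < T.lev (T.w t) := by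
  have := T.len_eq
  rw [T.lev_w t (by omega)]
  omega

theorem lev_out {i : ℕ} (hi : 1 ≤ i) (hi' : i ≤ N + 1) : T.lev (T.w (e + i)) = i := by
  have := T.len_eq
  rw [T.lev_w _ (by omega)]
  omega

theorem lev_back {i : ℕ} (hi : 1 ≤ i) (hi' : i ≤ N + 1) : T.lev (T.w (T.len - i)) = i := by
  have := T.len_eq
  rw [T.lev_w _ (by omega)]
  omega

theorem w_out_add_len {i : ℕ} : T.w (T.len + e + i) = T.w (e + i) := by
  rw [← T.periodic (e + i)]
  congr 1
  omega

theorem w_back {i : ℕ} (hi : 1 ≤ i) (hi' : i ≤ N + 1) : T.w (T.len - i) = T.w (e + i) := by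
  apply T.lev_inj <;> rw [T.lev_back hi hi']
  · omega
  · omega
  · rw [T.lev_out hi hi']

theorem eq_w_out {i : ℕ} (hi : 1 ≤ i) (hi' : i ≤ N + 1) {v : V} (hv : T.lev v = i) :
    T.w (e + i) = v := by
  apply T.lev_inj <;> rw [T.lev_out hi hi']
  · omega
  · omega
  · exact hv.symm

theorem visits_out_add_len (v : V) (i : ℕ) :
    T.visits v (T.len + e + i) = T.visits v (e + i) + G.degree v := by
  rw [← T.visits_add_len]
  congr 1
  omega

theorem visits_back_of_lev_lt {i : ℕ} (hi : 1 ≤ i) (hi' : i ≤ N + 1) {v : V}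
    (hv : T.lev v < i) : T.visits v (T.len + e + i) = T.visits v (T.len - i + 1) + G.degree v := by
  have := T.len_eq
  rw [T.visits_out_add_len]
  congr 1
  symm
  refine T.visits_eq_of_forall_ne v (by omega) fun r h₁ h₂ hr => ?_
  subst hr
  rw [T.lev_w r (by omega)] at hv
  omega

theorem visits_out_of_lt_lev {i : ℕ} (hi : 1 ≤ i) (hi' : i ≤ N + 1) {v : V}
    (hv : i < T.lev v) : T.visits v (T.len - i) = T.visits v (e + i + 1) + G.degree v := by
  have := T.len_eq
  rw [← T.visits_add_len]
  symm
  refine T.visits_eq_of_forall_ne v (by omega) fun r h₁ h₂ hr => ?_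
  subst hr
  rcases le_total r T.len with h | h
  · rw [T.lev_w r h] at hv
    omega
  · obtain ⟨s, rfl⟩ := Nat.exists_eq_add_of_le h
    rw [T.lev_w_add_len (by omega)] at hv
    omega

theorem visits_back_of_lev_eq {i : ℕ} (hi : 1 ≤ i) (hi' : i ≤ N + 1) {v : V}
    (hv : T.lev v = i) : T.visits v (T.len - i) = T.visits v (e + i) + 1 := by
  have := T.len_eq
  have h := T.visits_succ v (e + i)
  rw [if_pos (T.eq_w_out hi hi' hv)] at h
  rw [← h]
  refine T.visits_eq_of_forall_ne v (by omega) fun r h₁ h₂ hr => ?_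
  subst hr
  rw [T.lev_w r (by omega)] at hv
  omega

theorem visits_out_of_lev_eq {i : ℕ} (hi : 1 ≤ i) (hi' : i ≤ N + 1) {v : V}
    (hv : T.lev v = i) : T.visits v (e + i) + G.degree v = T.visits v (T.len - i) + 1 := by
  have := T.len_eq
  have h := T.visits_succ v (T.len - i)
  rw [if_pos ((T.w_back hi hi').trans (T.eq_w_out hi hi' hv))] at h
  rw [← h, ← T.visits_out_add_len]
  refine T.visits_eq_of_forall_ne v (by omega) fun r h₁ h₂ hr => ?_
  subst hr
  exact (T.lev_lt hi hi' (by omega) (by omega)).ne hv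

/-- The time up to which the visits to `v` determine the rotor of `v`. -/
def phase (z : Config) (v : V) : ℕ :=
  if T.lev v < z.i then T.len + e + z.i - z.x
  else if z.i < T.lev v then T.len - z.i - z.y
  else if z.right then e + z.i else T.len - z.i

/-- The state of the rotor-router system described by a configuration. -/
def toState (z : Config) : State G where
  ptr v := T.visits v (T.phase z v) % G.degree v
  tokens v := (if T.w (T.len + e + z.i - z.x) = v then 1 else 0) +
    if T.w (T.len - z.i - z.y) = v then 1 else 0
  ptr_lt _ h := Nat.mod_lt _ h

theorem phase_of_lt {z : Config} {v : V} (h : T.lev v < z.i) :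
    T.phase z v = T.len + e + z.i - z.x := if_pos h

theorem phase_of_gt {z : Config} {v : V} (h : z.i < T.lev v) :
    T.phase z v = T.len - z.i - z.y := by
  rw [phase, if_neg (by omega), if_pos h]

theorem phase_of_eq {z : Config} {v : V} (h : T.lev v = z.i) :
    T.phase z v = if z.right then e + z.i else T.len - z.i := by
  rw [phase, if_neg (by omega), if_neg (by omega)]

variable {ord}

theorem step_toState_eq {z z' : Config} {j₁ j₂ c : ℕ} (hT : T.Follows ord)
    (hw₁ : T.w j₁ = T.w (T.len + e + z.i - z.x)) (hw₂ : T.w j₂ = T.w (T.len - z.i - z.y))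
    (hw₁' : T.w (j₁ + 1) = T.w (T.len + e + z'.i - z'.x))
    (hw₂' : T.w (j₂ + 1) = T.w (T.len - z'.i - z'.y)) (hc : c ≤ 1)
    (h₁ : T.visits (T.w j₁) (T.phase z (T.w j₁)) + (if T.w j₁ = T.w j₂ then c else 0) ≡
      T.visits (T.w j₁) j₁ [MOD G.degree (T.w j₁)])
    (h₂ : T.visits (T.w j₂) (T.phase z (T.w j₂)) + (if T.w j₁ = T.w j₂ then 1 - c else 0) ≡
      T.visits (T.w j₂) j₂ [MOD G.degree (T.w j₂)])
    (h : ∀ v, T.visits v (T.phase z' v) ≡ T.visits v (T.phase z v) +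
      ((if T.w j₁ = v then 1 else 0) + if T.w j₂ = v then 1 else 0) [MOD G.degree v]) :
    step G ord (T.toState z) = T.toState z' := by
  refine step_eq_of_two_tokens (d₁ := T.dartAt j₁) (d₂ := T.dartAt j₂) ?_ hc ?_ ?_ ?_ ?_
    T.degree_pos
  · intro v
    show _ = (if T.w j₁ = v then 1 else 0) + (if T.w j₂ = v then 1 else 0)
    rw [hw₁, hw₂]
    rfl
  · rw [hT j₁]
    exact (Nat.mod_add_mod _ _ _).trans h₁
  · rw [hT j₂]
    exact (Nat.mod_add_mod _ _ _).trans h₂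
  · intro v
    show T.visits v (T.phase z' v) % G.degree v % G.degree v =
      (T.visits v (T.phase z v) % G.degree v + ((if T.w (T.len + e + z.i - z.x) = v then 1 else 0) +
        if T.w (T.len - z.i - z.y) = v then 1 else 0)) % G.degree v
    rw [← hw₁, ← hw₂, Nat.mod_mod, Nat.mod_add_mod]
    exact h v
  · intro v
    show _ = (if T.w (j₁ + 1) = v then 1 else 0) + (if T.w (j₂ + 1) = v then 1 else 0)
    rw [hw₁', hw₂']
    rfl

theorem step_toState {z : Config} (hT : T.Follows ord) (hz : z.Valid e N) (he : e % 2 = 0) :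
    step G ord (T.toState z) = T.toState (z.next e N) := by
  have hc := z.next_cases hz
  obtain ⟨hi, hi', hxl, hyl, hpar, -, -⟩ := hz
  have hlen := T.len_eq
  have hu := T.lev_out hi hi'
  have hub := T.lev_back hi hi'
  have hwb := T.w_back hi hi'
  have hwo := T.w_out_add_len (i := z.i)
  have hne : ∀ {u v : V}, T.lev u ≠ T.lev v → u ≠ v := fun h e => h (congrArg T.lev e)
  rcases hc with ⟨hx, hy, h⟩ | ⟨hx, hy, hp, h⟩ | ⟨hx, hy, hp, h⟩ | ⟨hx, hy, h⟩ |
    ⟨hx, hy, hp, hiN, h⟩ <;> rw [h]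
  · -- both tokens are away from the border
    have hA := T.lev_lt (t := T.len + e + z.i - z.x) hi hi' (by omega) (by omega)
    have hB := T.lt_lev (t := T.len - z.i - z.y) hi hi' (by omega) (by omega)
    have eA : T.len + e + z.i - (z.x - 1) = T.len + e + z.i - z.x + 1 := by omega
    have eB : T.len - z.i - (z.y - 1) = T.len - z.i - z.y + 1 := by omega
    refine T.step_toState_eq (j₁ := T.len + e + z.i - z.x) (j₂ := T.len - z.i - z.y) hT rfl rfl
      (by rw [eA]) (by rw [eB]) zero_le_one ?_ ?_ fun v => ?_
    · rw [T.phase_of_lt hA, if_neg (hne (by omega)), add_zero]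
    · rw [T.phase_of_gt hB, if_neg (hne (by omega)), add_zero]
    · rcases lt_trichotomy (T.lev v) z.i with hv | hv | hv
      · rw [T.phase_of_lt (by exact hv), T.phase_of_lt hv,
          if_neg (hne (by omega) : ¬ T.w (T.len - z.i - z.y) = v),
          add_zero, ← T.visits_succ, eA]
      · rw [T.phase_of_eq (by exact hv), T.phase_of_eq hv, if_neg (hne (by omega)),
          if_neg (hne (by omega))]
        rfl
      · rw [T.phase_of_gt (by exact hv), T.phase_of_gt hv, if_neg (hne (by omega)), zero_add,
          ← T.visits_succ, eB]
  · -- the left token turns back at the border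
    have hB := T.lt_lev (t := T.len - z.i - z.y) hi hi' (by omega) (by omega)
    have eA : T.len + e + z.i - (e + 2 * z.i - 1) = T.len - z.i + 1 := by omega
    have eB : T.len - z.i - (z.y - 1) = T.len - z.i - z.y + 1 := by omega
    refine T.step_toState_eq (j₁ := T.len - z.i) (j₂ := T.len - z.i - z.y) hT
      (by rw [hx, Nat.sub_zero, hwo, hwb]) rfl (by rw [eA]) (by rw [eB]) zero_le_one ?_ ?_
      fun v => ?_
    · rw [T.phase_of_eq hub, hp, if_neg (hne (by omega)), add_zero]
      rfl
    · rw [T.phase_of_gt hB, if_neg (hne (by omega)), add_zero]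
    · rcases lt_trichotomy (T.lev v) z.i with hv | hv | hv
      · rw [T.phase_of_lt (by exact hv), T.phase_of_lt hv, if_neg (hne (by omega)),
          if_neg (hne (by omega)), eA, hx, Nat.sub_zero, T.visits_back_of_lev_lt hi hi' hv]
        exact (Nat.add_modEq_right).symm
      · rw [T.phase_of_eq (by exact hv), T.phase_of_eq hv, hp, hwb, if_pos (T.eq_w_out hi hi' hv),
          if_neg (hne (by omega))]
        have := T.visits_out_of_lev_eq hi hi' hv
        show T.visits v (e + z.i) ≡ T.visits v (T.len - z.i) + 1 [MOD G.degree v]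
        rw [← this]
        exact (Nat.add_modEq_right).symm
      · rw [T.phase_of_gt (by exact hv), T.phase_of_gt hv, if_neg (hne (by omega)), zero_add,
          ← T.visits_succ, eB]
  · -- the right token turns back at the border
    have hA := T.lev_lt (t := T.len + e + z.i - z.x) hi hi' (by omega) (by omega)
    have eA : T.len + e + z.i - (z.x - 1) = T.len + e + z.i - z.x + 1 := by omega
    have eB : T.len - z.i - (e + 4 * N + 3 - 2 * z.i) = e + z.i + 1 := by omega
    refine T.step_toState_eq (j₁ := T.len + e + z.i - z.x) (j₂ := e + z.i) hT rfl
      (by rw [hy, Nat.sub_zero, hwb]) (by rw [eA]) (by rw [eB]) zero_le_one ?_ ?_ fun v => ?_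
    · rw [T.phase_of_lt hA, if_neg (hne (by omega)), add_zero]
    · rw [T.phase_of_eq hu, hp, if_neg (hne (by omega)), add_zero]
      rfl
    · rcases lt_trichotomy (T.lev v) z.i with hv | hv | hv
      · rw [T.phase_of_lt (by exact hv), T.phase_of_lt hv,
          if_neg (hne (by omega) : ¬ T.w (e + z.i) = v),
          add_zero, ← T.visits_succ, eA]
      · rw [T.phase_of_eq (by exact hv), T.phase_of_eq hv, hp, if_pos (T.eq_w_out hi hi' hv),
          if_neg (hne (by omega))]
        show T.visits v (T.len - z.i) ≡ T.visits v (e + z.i) + (0 + 1) [MOD G.degree v]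
        rw [T.visits_back_of_lev_eq hi hi' hv]
      · rw [T.phase_of_gt (by exact hv), T.phase_of_gt hv, if_neg (hne (by omega)),
          if_neg (hne (by omega)), eB, hy, Nat.sub_zero, T.visits_out_of_lt_lev hi hi' hv]
        exact (Nat.add_modEq_right).symm
  · -- the two tokens meet at the border
    have eA : T.len + e + z.i - (e + 2 * z.i - 1) = T.len - z.i + 1 := by omega
    have eB : T.len - z.i - (e + 4 * N + 3 - 2 * z.i) = e + z.i + 1 := by omega
    have h₁ := T.visits_back_of_lev_eq hi hi' hu
    have h₂ := T.visits_out_of_lev_eq hi hi' hu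
    refine T.step_toState_eq (j₁ := T.len - z.i) (j₂ := e + z.i) (c := if z.right then 1 else 0) hT
      (by rw [hx, Nat.sub_zero, hwo, hwb]) (by rw [hy, Nat.sub_zero, hwb]) (by rw [eA])
      (by rw [eB]) (by split_ifs <;> omega) ?_ ?_ fun v => ?_
    · rw [hwb, if_pos rfl, T.phase_of_eq hu]
      cases z.right
      · rfl
      · exact congrArg (· % _) h₁.symm
    · rw [hwb, if_pos rfl, T.phase_of_eq hu]
      cases z.right
      · show _ + 1 ≡ _ [MOD _]
        simp only [Bool.false_eq_true, if_false]
        rw [← h₂]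
        exact Nat.add_modEq_right
      · rfl
    · rcases lt_trichotomy (T.lev v) z.i with hv | hv | hv
      · rw [T.phase_of_lt (by exact hv), T.phase_of_lt hv, if_neg (hne (by omega)),
          if_neg (hne (by omega)), eA, hx, Nat.sub_zero, T.visits_back_of_lev_lt hi hi' hv]
        exact (Nat.add_modEq_right).symm
      · have hvis : T.visits v (e + z.i) + G.degree v = T.visits v (e + z.i) + (1 + 1) := by
          rw [T.visits_out_of_lev_eq hi hi' hv, T.visits_back_of_lev_eq hi hi' hv]
        have hdeg : G.degree v = 2 := by omega
        rw [T.phase_of_eq (by exact hv), T.phase_of_eq hv, hwb, if_pos (T.eq_w_out hi hi' hv), hdeg]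
        exact (Nat.add_modEq_right).symm
      · rw [T.phase_of_gt (by exact hv), T.phase_of_gt hv, if_neg (hne (by omega)),
          if_neg (hne (by omega)), eB, hy, Nat.sub_zero, T.visits_out_of_lt_lev hi hi' hv]
        exact (Nat.add_modEq_right).symm
  · -- the left token pushes the border
    have hB : z.i + 1 < T.lev (T.w (T.len - z.i - z.y)) :=
      T.lt_lev (by omega) (by omega) (by omega) (by omega)
    have hN : T.lev (T.w (e + z.i)) = z.i := hu
    have eA : T.len + e + (z.i + 1) - 0 = T.len + e + z.i + 1 := by omega
    have eB : T.len - (z.i + 1) - (z.y - 2) = T.len - z.i - z.y + 1 := by omega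
    refine T.step_toState_eq (j₁ := T.len + e + z.i) (j₂ := T.len - z.i - z.y) hT
      (by rw [hx, Nat.sub_zero]) rfl (by rw [eA]) (by rw [eB]) zero_le_one ?_ ?_ fun v => ?_
    · rw [hwo, T.phase_of_eq hu, hp, if_neg (hne (by omega)), add_zero, T.visits_out_add_len]
      exact (Nat.add_modEq_right).symm
    · rw [T.phase_of_gt (by omega), if_neg (hne (by rw [hwo]; omega)), add_zero]
    · rcases lt_trichotomy (T.lev v) z.i with hv | hv | hv
      · rw [T.phase_of_lt (by simp only; omega), T.phase_of_lt hv,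
          if_neg (hne (by omega) : ¬ T.w (T.len - z.i - z.y) = v),
          add_zero, eA, T.visits_succ, hwo, if_neg (hne (by omega)), hx]
        rfl
      · rw [T.phase_of_lt (by simp only; omega), T.phase_of_eq hv, hp,
          if_neg (hne (by omega) : ¬ T.w (T.len - z.i - z.y) = v), add_zero, eA, T.visits_succ,
          T.visits_out_add_len,
          add_right_comm]
        exact Nat.add_modEq_right
      · rw [T.phase_of_gt hv, hwo, if_neg (hne (by omega)), zero_add, ← T.visits_succ]
        rcases Nat.lt_or_ge (z.i + 1) (T.lev v) with hv' | hv'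
        · rw [T.phase_of_gt (by exact hv'), eB]
        · have hv' : T.lev v = z.i + 1 := by omega
          rw [T.phase_of_eq (by exact hv')]
          refine congrArg (· % _) (T.visits_eq_of_forall_ne v ?_ fun r h₁ h₂ => ?_)
          · show _ ≤ T.len - (z.i + 1)
            omega
          · have h₂ : r < T.len - (z.i + 1) := h₂
            have := T.lt_lev (i := z.i + 1) (t := r) (by omega) (by omega) (by omega) (by omega)
            exact hne (by omega)

end LeveledTour

end LeveledTour

section Clock

namespace Config

/-- A clock advancing by one at each step that does not move the border. -/
noncomputable def clock (e N : ℕ) (z : Config) : ℝ :=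
  (e + 4 * N + 4 - 2 * z.i) / (4 * (N + 1 - z.i)) *
    (z.y - z.x + if z.right then (e + 2 * z.i : ℝ) else 0) + (e + 4 * N + 4 - 2 * z.i - z.y)

variable {e N : ℕ} {z : Config}

theorem clock_next_of_i_eq (hz : z.Valid e N) (hN : z.i ≤ N) (h : (z.next e N).i = z.i) :
    (z.next e N).clock e N = z.clock e N + 1 := by
  have hd : (0 : ℝ) < N + 1 - z.i := by
    have : (z.i : ℝ) ≤ N := by exact_mod_cast hN
    linarith
  have hc := z.next_cases hz
  obtain ⟨h1, h2, h3, h4, h5, h6, h7⟩ := hz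
  rcases hc with ⟨hx, hy, h'⟩ | ⟨hx, hy, hp, h'⟩ | ⟨hx, hy, hp, h'⟩ | ⟨hx, hy, h'⟩ |
    ⟨hx, hy, hp, hi, h'⟩ <;> rw [h'] at h ⊢ <;> simp only [clock]
  · rw [Nat.cast_sub (show 1 ≤ z.x by omega), Nat.cast_sub (show 1 ≤ z.y by omega)]
    push_cast
    ring
  · rw [Nat.cast_sub (show 1 ≤ e + 2 * z.i by omega), Nat.cast_sub (show 1 ≤ z.y by omega), hx, hp]
    push_cast
    ring
  · rw [Nat.cast_sub (show 1 ≤ z.x by omega),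
      Nat.cast_sub (show 2 * z.i ≤ e + 4 * N + 3 by omega), hy, hp]
    push_cast
    simp only [if_true]
    field_simp
    ring
  · rw [Nat.cast_sub (show 1 ≤ e + 2 * z.i by omega),
      Nat.cast_sub (show 2 * z.i ≤ e + 4 * N + 3 by omega), hx, hy]
    push_cast
    field_simp
    ring
  · simp at h

theorem clock_next_of_i_ne (he : 4 ≤ e) (hz : z.Valid e N) (hN : (z.next e N).i ≤ N)
    (h : (z.next e N).i ≠ z.i) :
    (z.next e N).clock e N + (e : ℝ) ^ 2 / (8 * (N + 1 - z.i)) ≤ z.clock e N + 1 := by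
  obtain ⟨hx, hy, hp, h'⟩ := next_eq_of_i_ne hz h
  obtain ⟨h1, h2, h3, h4, h5, h6, h7⟩ := hz
  have hyd := h7 hp
  rw [h'] at hN ⊢
  simp only at hN
  simp only [clock, hx, hp, if_true, Bool.false_eq_true, if_false]
  rw [Nat.cast_sub hy]
  push_cast
  have hi : (z.i : ℝ) + 1 ≤ N := by exact_mod_cast hN
  have he' : (4 : ℝ) ≤ e := by exact_mod_cast he
  have hy' : (2 : ℝ) ≤ z.y := by exact_mod_cast hy
  have hi1 : (1 : ℝ) ≤ z.i := by exact_mod_cast h1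
  have hyd' : (z.y : ℝ) ≤ 4 * (N + 1 - z.i) := by
    have : (z.y : ℝ) + 4 * z.i ≤ z.x + (4 * N + 4) := by exact_mod_cast hyd
    rw [hx] at this
    push_cast at this
    linarith
  obtain ⟨δ, hδ⟩ : ∃ δ : ℝ, δ = N - z.i := ⟨_, rfl⟩
  obtain ⟨b, hb⟩ : ∃ b : ℝ, b = e + 4 * N + 4 - 2 * z.i := ⟨_, rfl⟩
  have hδ1 : 1 ≤ δ := by linarith
  have hbe : (e : ℝ) ≤ b := by linarith
  have e1 : (e + 4 * N + 4 - 2 * (z.i + 1 : ℝ)) / (4 * (N + 1 - (z.i + 1))) * (z.y - 2 - 0 + 0) ≤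
      b / (4 * (N + 1 - z.i)) * (z.y + 4) := by
    rw [div_mul_eq_mul_div, div_mul_eq_mul_div, div_le_div_iff₀ (by linarith) (by linarith)]
    have k1 : (z.y - 2 : ℝ) * (δ + 1) ≤ (z.y + 4) * δ := by nlinarith
    have k2 : 0 ≤ (z.y - 2 : ℝ) * (δ + 1) := by nlinarith
    have k3 := mul_le_mul_of_nonneg_left k1 (show 0 ≤ b by linarith)
    have e2 : (e + 4 * N + 4 - 2 * (z.i + 1 : ℝ)) = b - 2 := by linarith
    rw [e2, show (N + 1 - z.i : ℝ) = δ + 1 by linarith,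
      show (N + 1 - (z.i + 1) : ℝ) = δ by linarith]
    nlinarith
  have e2 : (e : ℝ) ^ 2 / (8 * (N + 1 - z.i)) ≤ b / (4 * (N + 1 - z.i)) * (e + 2 * z.i - 4) := by
    rw [div_mul_eq_mul_div, div_le_div_iff₀ (by linarith) (by linarith),
      show (N + 1 - z.i : ℝ) = δ + 1 by linarith]
    have k1 : (e : ℝ) ^ 2 ≤ 2 * (b * (e + 2 * z.i - 4)) := by nlinarith
    have := mul_le_mul_of_nonneg_right k1 (show 0 ≤ 4 * (δ + 1) by linarith)
    nlinarith
  rw [← hb]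
  nlinarith

theorem clock_nonneg (hz : z.Valid e N) (hN : z.i ≤ N) : 0 ≤ z.clock e N := by
  obtain ⟨h1, h2, h3, h4, h5, h6, h7⟩ := hz
  have hi : (z.i : ℝ) ≤ N := by exact_mod_cast hN
  have h3' : (z.x : ℝ) < e + 2 * z.i := by exact_mod_cast h3
  have h4' : (z.y : ℝ) + 2 * z.i < e + 4 * N + 4 := by exact_mod_cast h4
  have hy : (0 : ℝ) ≤ z.y := Nat.cast_nonneg _
  rw [clock]
  refine add_nonneg (mul_nonneg (div_nonneg (by linarith) (by linarith)) ?_) (by linarith)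
  cases hp : z.right
  · have : (z.x : ℝ) ≤ z.y := by exact_mod_cast h6 hp
    simpa using this
  · simp only [if_true]
    linarith

theorem clock_le (hz : z.Valid e N) (hN : z.i ≤ N) :
    z.clock e N ≤ 2 * (e + 4 * N + 4) ^ 2 + (e + 4 * N + 4) := by
  obtain ⟨h1, h2, h3, h4, h5, h6, h7⟩ := hz
  have hi : (z.i : ℝ) ≤ N := by exact_mod_cast hN
  have h4' : (z.y : ℝ) + 2 * z.i < e + 4 * N + 4 := by exact_mod_cast h4
  have hy : (0 : ℝ) ≤ z.y := Nat.cast_nonneg _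
  have hx : (0 : ℝ) ≤ z.x := Nat.cast_nonneg _
  have hi0 : (0 : ℝ) ≤ z.i := Nat.cast_nonneg _
  have he : (0 : ℝ) ≤ e := Nat.cast_nonneg _
  rw [clock]
  refine add_le_add ?_ (by linarith)
  have k1 : (e + 4 * N + 4 - 2 * z.i : ℝ) / (4 * (N + 1 - z.i)) ≤ e + 4 * N + 4 := by
    rw [div_le_iff₀ (by linarith)]
    nlinarith
  have k2 : (z.y - z.x + if z.right then (e + 2 * z.i : ℝ) else 0) ≤ 2 * (e + 4 * N + 4) := by
    split_ifs <;> linarith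
  have k3 : (0 : ℝ) ≤ (e + 4 * N + 4 - 2 * z.i : ℝ) / (4 * (N + 1 - z.i)) :=
    div_nonneg (by linarith) (by linarith)
  nlinarith

theorem exists_le_iterate_i (he : e % 2 = 0) (he0 : 0 < e) {j : ℕ} (hj : j ≤ N + 1) :
    ∃ t, j ≤ ((next e N)^[t] init).i := by
  have hv := valid_iterate (N := N) he he0 valid_init
  have hm := i_mono (N := N) he he0 valid_init
  induction j with
  | zero => exact ⟨0, Nat.zero_le _⟩
  | succ j ih =>
    obtain ⟨s, hs⟩ := ih (by omega)
    by_contra! hcon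
    have hi : ∀ t, ((next e N)^[t + s] init).i = j := fun t => by
      have h₁ : ((next e N)^[s] init).i ≤ ((next e N)^[t + s] init).i :=
        hm (Nat.le_add_left s t)
      have h₂ := hcon (t + s)
      omega
    have hclock : ∀ t : ℕ, ((next e N)^[t + s] init).clock e N =
        ((next e N)^[s] init).clock e N + t := by
      intro t
      induction t with
      | zero => simp
      | succ t iht =>
        have h₁ := hi (t + 1)
        rw [show t + 1 + s = t + s + 1 by omega, Function.iterate_succ_apply'] at h₁ ⊢
        rw [clock_next_of_i_eq (hv _) (by rw [hi t]; omega) (h₁.trans (hi t).symm), iht]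
        push_cast
        ring
    have hs' := hi 0
    rw [Nat.zero_add] at hs'
    have h₀ := clock_nonneg (hv s) (by rw [hs']; omega)
    obtain ⟨t, ht⟩ := exists_nat_gt (2 * (e + 4 * N + 4) ^ 2 + (e + 4 * N + 4) : ℝ)
    have h₁ := clock_le (hv (t + s)) (by rw [hi t]; omega)
    rw [hclock] at h₁
    linarith

theorem clock_iterate_le (he : e % 2 = 0) (he0 : 4 ≤ e) {t : ℕ}
    (ht : ((next e N)^[t] init).i ≤ N) :
    ((next e N)^[t] init).clock e N + (e : ℝ) ^ 2 / 8 *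
      (Real.log (N + 1) - Real.log (N + 2 - ((next e N)^[t] init).i)) ≤ e + 4 * N + 2 + t := by
  have hv := valid_iterate (N := N) he (by omega) valid_init
  induction t with
  | zero =>
    simp only [Function.iterate_zero, id, clock, init]
    norm_num
    rw [show (N + 2 - 1 : ℝ) = N + 1 by ring]
    linarith
  | succ t ih =>
    rw [Function.iterate_succ_apply'] at ht ⊢
    have hle := i_le_next (hv t)
    have ih := ih (hle.trans ht)
    push_cast
    by_cases h : (next e N ((next e N)^[t] init)).i = ((next e N)^[t] init).i
    · rw [clock_next_of_i_eq (hv t) (hle.trans ht) h, h]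
      linarith
    · have h₁ := clock_next_of_i_ne he0 (hv t) ht h
      obtain ⟨-, -, -, h₂⟩ := next_eq_of_i_ne (hv t) h
      have h₃ : (next e N ((next e N)^[t] init)).i = ((next e N)^[t] init).i + 1 := by rw [h₂]
      rw [h₃] at ht ⊢
      have hi : (((next e N)^[t] init).i : ℝ) + 1 ≤ N := by exact_mod_cast ht
      set i : ℝ := (((next e N)^[t] init).i : ℝ)
      have hpos : 0 < (N + 1 - i : ℝ) := by linarith
      have hlog : Real.log (N + 2 - i) - Real.log (N + 2 - (i + 1)) ≤ 1 / (N + 1 - i) := by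
        rw [← Real.log_div (by linarith) (by linarith)]
        refine (Real.log_le_sub_one_of_pos (div_pos (by linarith) (by linarith))).trans_eq ?_
        rw [show (N + 2 - (i + 1) : ℝ) = N + 1 - i by ring]
        field_simp
        ring
      have h₄ := mul_le_mul_of_nonneg_left hlog (show (0 : ℝ) ≤ (e : ℝ) ^ 2 / 8 by positivity)
      rw [show (e : ℝ) ^ 2 / 8 * (1 / (N + 1 - i)) = (e : ℝ) ^ 2 / (8 * (N + 1 - i)) by
        field_simp] at h₄
      push_cast
      linarith

theorem le_of_iterate_i_eq (he : e % 2 = 0) (he0 : 4 ≤ e) {t : ℕ}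
    (ht : ((next e N)^[t] init).i = N) :
    (e : ℝ) ^ 2 / 8 * (Real.log (N + 1) - Real.log 2) ≤ e + 4 * N + 2 + t := by
  have h := clock_iterate_le he he0 ht.le
  have h₀ := clock_nonneg (valid_iterate he (by omega) valid_init t) ht.le
  rw [ht, show (N + 2 - N : ℝ) = 2 by ring] at h
  linarith

end Config

end Clock

section Stabilization

set_option linter.unusedSectionVars false

open Config

namespace LeveledTour

variable {G ord} {e N : ℕ} (T : LeveledTour G e N)

theorem evol_toState (hT : T.Follows ord) (he : e % 2 = 0) (he0 : 0 < e) {z : Config}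
    (hz : z.Valid e N) (t : ℕ) :
    evol G ord (T.toState z) t = T.toState ((next e N)^[t] z) := by
  induction t with
  | zero => rfl
  | succ t ih =>
    rw [Function.iterate_succ_apply', ← T.step_toState hT (valid_iterate he he0 hz t) he, ← ih]
    exact Function.iterate_succ_apply' _ _ _

theorem exists_isStable (hT : T.Follows ord) (he : e % 2 = 0) (he0 : 0 < e) :
    ∃ t, IsStable G ord (T.toState init) t := by
  have hv := valid_iterate (N := N) he he0 valid_init
  let f : ℕ → Fin (N + 2) × Fin (e + 4 * N + 4) × Fin (e + 4 * N + 4) × Bool := fun t =>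
    (⟨((next e N)^[t] init).i, by have := (hv t).le; omega⟩,
      ⟨((next e N)^[t] init).x, by have := (hv t).x_lt; have := (hv t).le; omega⟩,
      ⟨((next e N)^[t] init).y, by have := (hv t).y_lt; omega⟩, ((next e N)^[t] init).right)
  obtain ⟨s, t, hne, hf⟩ := Finite.exists_ne_map_eq_of_infinite f
  simp only [f, Prod.mk.injEq, Fin.mk.injEq] at hf
  have heq : (next e N)^[s] init = (next e N)^[t] init := by
    generalize (next e N)^[s] init = z at hf
    generalize (next e N)^[t] init = z' at hf
    obtain ⟨_, _, _, _⟩ := z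
    obtain ⟨_, _, _, _⟩ := z'
    simpa using hf
  rcases hne.lt_or_gt with h | h
  · refine ⟨s, t, h, ?_⟩
    rw [T.evol_toState hT he he0 valid_init, T.evol_toState hT he he0 valid_init, heq]
  · refine ⟨t, s, h, ?_⟩
    rw [T.evol_toState hT he he0 valid_init, T.evol_toState hT he he0 valid_init, heq]

theorem lev_left_le {z : Config} (hz : z.Valid e N) :
    T.lev (T.w (T.len + e + z.i - z.x)) ≤ z.i := by
  have h := hz.x_lt
  have hlen := T.len_eq
  rcases Nat.eq_zero_or_pos z.x with hx | hx
  · rw [hx, Nat.sub_zero, T.w_out_add_len, T.lev_out hz.one_le hz.le]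
  · exact (T.lev_lt hz.one_le hz.le (by omega) (by omega)).le

theorem le_lev_right {z : Config} (hz : z.Valid e N) :
    z.i ≤ T.lev (T.w (T.len - z.i - z.y)) := by
  have h := hz.y_lt
  have h' := hz.le
  have hlen := T.len_eq
  rw [T.lev_w _ (by omega)]
  omega

theorem not_isStable (hT : T.Follows ord) (he : e % 2 = 0) (he0 : 0 < e) {t s : ℕ} (hts : t ≤ s)
    (hi : ((next e N)^[s] init).i ≤ N) (hy : ((next e N)^[s] init).y = 0) :
    ¬ IsStable G ord (T.toState init) t := by
  rintro ⟨t', ht', h⟩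
  have hv := valid_iterate (N := N) he he0 valid_init
  obtain ⟨p, rfl⟩ := Nat.exists_eq_add_of_lt ht'
  obtain ⟨r, rfl⟩ := Nat.exists_eq_add_of_le hts
  obtain ⟨q, hq⟩ := exists_le_iterate_i (N := N) he he0 le_rfl
  have hper : Function.IsPeriodicPt (step G ord) (p + 1)
      ((step G ord)^[t] (T.toState init)) := by
    show (step G ord)^[p + 1] _ = _
    rw [← Function.iterate_add_apply, add_comm]
    exact h
  have hper' := ((hper.apply_iterate r).mul_const q).eq
  rw [← Function.iterate_add_apply, ← Function.iterate_add_apply, ← Function.iterate_add_apply,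
    add_assoc, add_comm r t] at hper'
  change evol G ord _ _ = evol G ord _ _ at hper'
  rw [T.evol_toState hT he he0 valid_init, T.evol_toState hT he he0 valid_init] at hper'
  have hi' := (i_mono (N := N) he he0 valid_init
    (show q ≤ (p + 1) * q + (t + r) by nlinarith)).trans' hq
  simp only at hi'
  have hz' := hv ((p + 1) * q + (t + r))
  have hz := hv (t + r)
  generalize (next e N)^[(p + 1) * q + (t + r)] init = z' at hper' hi' hz'
  generalize (next e N)^[t + r] init = z at hi hy hz hper'
  have htok := congrArg (fun S => S.tokens (T.w (T.len - z'.i - z'.y))) hper'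
  have hl := T.le_lev_right hz'
  have h₁ := T.lev_left_le hz
  have h₂ := T.lev_back hz.one_le hz.le
  simp only [toState, if_true] at htok
  rw [hy, Nat.sub_zero,
    if_neg (show ¬ T.w (T.len + e + z.i - z.x) = T.w (T.len - z'.i - z'.y) from
      fun h => by rw [h] at h₁; omega),
    if_neg (show ¬ T.w (T.len - z.i) = T.w (T.len - z'.i - z'.y) from
      fun h => by rw [h] at h₂; omega)] at htok
  omega

theorem exists_iterate_i_eq_and_y_eq_zero (he : e % 2 = 0) (he0 : 8 ≤ e) (hN : 2 ≤ N) :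
    ∃ t s, t ≤ s ∧ ((next e N)^[t] init).i = N ∧
      ((next e N)^[s] init).i = N ∧ ((next e N)^[s] init).y = 0 := by
  classical
  have hv := valid_iterate (N := N) he (by omega) valid_init
  have hex := exists_le_iterate_i (N := N) (j := N) he (by omega) (by omega)
  have hspec := Nat.find_spec hex
  have hmin := fun t => Nat.find_min hex (m := t)
  generalize Nat.find hex = τ at hspec hmin
  obtain ⟨t, rfl⟩ : ∃ t, τ = t + 1 := by
    refine Nat.exists_eq_succ_of_ne_zero ?_
    rintro rfl
    simp only [Function.iterate_zero, id, init] at hspec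
    omega
  have hlt := hmin t (by omega)
  rw [Function.iterate_succ_apply'] at hspec
  obtain ⟨hx, hy, hp, h⟩ := next_eq_of_i_ne (hv t) (by omega)
  have hz := hv t
  have hzy := hz.of_right hp
  have hi : (next e N ((next e N)^[t] init)).i = N := by rw [h] at hspec ⊢; simp only at *; omega
  suffices ∃ s, ((next e N)^[s] (next e N ((next e N)^[t] init))).i = N ∧
      ((next e N)^[s] (next e N ((next e N)^[t] init))).y = 0 by
    obtain ⟨s, hs⟩ := this
    refine ⟨t + 1, s + (t + 1), by omega, by rw [Function.iterate_succ_apply']; exact hi, ?_⟩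
    rw [Function.iterate_add_apply, Function.iterate_succ_apply']
    exact hs
  have hv' := hz.next he (by omega)
  generalize (next e N)^[t] init = z at *
  rw [h] at hi hv' ⊢
  simp only at hi
  rw [hi] at hv' ⊢
  rcases Nat.eq_zero_or_pos (z.y - 2) with h0 | h0
  · exact ⟨0, rfl, h0⟩
  · have hn : next e N ⟨N, 0, z.y - 2, false⟩ = ⟨N, e + 2 * N - 1, z.y - 2 - 1, true⟩ := by
      simp [next, h0.ne']
    obtain ⟨s, hs⟩ := exists_iterate_y_eq_zero_of_le (e := e) (N := N)
      (z := ⟨N, e + 2 * N - 1, z.y - 2 - 1, true⟩) (by simp only; omega)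
    exact ⟨s + 1, by rw [Function.iterate_succ_apply, hn]; exact hs⟩

theorem le_stabTime (hT : T.Follows ord) (he : e % 2 = 0) (he0 : 8 ≤ e) (hN : 2 ≤ N) :
    (e : ℝ) ^ 2 / 8 * (Real.log (N + 1) - Real.log 2) ≤
      e + 4 * N + 2 + stabTime G ord (T.toState init) := by
  obtain ⟨t, s, hts, ht, hsi, hsy⟩ := exists_iterate_i_eq_and_y_eq_zero he he0 hN
  have hle : t ≤ stabTime G ord (T.toState init) := by
    by_contra! hlt
    exact T.not_isStable hT he (by omega) (hlt.le.trans hts) hsi.le hsy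
      (Nat.sInf_mem (T.exists_isStable hT he (by omega)))
  have h := le_of_iterate_i_eq he (by omega) ht
  have : (t : ℝ) ≤ stabTime G ord (T.toState init) := by exact_mod_cast hle
  linarith

theorem sum_tokens (z : Config) : ∑ v, (T.toState z).tokens v = 2 := by
  simp [toState, Finset.sum_add_distrib]

end LeveledTour

end Stabilization

section Dumbbell

/-- The graph whose edges are those traversed by a walk. -/
def walkGraph {V : Type} (w : ℕ → V) : SimpleGraph V :=
  SimpleGraph.fromRel fun u v => ∃ t, w t = u ∧ w (t + 1) = v

/-- An Eulerian circuit of the complete bipartite graph on `Fin n` and `Fin d`, for coprime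
`n` and `d`. -/
def blobWalk (n d : ℕ) [NeZero n] [NeZero d] (t : ℕ) : Fin n ⊕ Fin d :=
  if t % 2 = 0 then .inl ⟨t / 2 % n, Nat.mod_lt _ (NeZero.pos n)⟩
  else .inr ⟨t / 2 % d, Nat.mod_lt _ (NeZero.pos d)⟩

section Blob

variable {n d : ℕ} [NeZero n] [NeZero d]

theorem blobWalk_even (t : ℕ) :
    blobWalk n d (2 * t) = .inl ⟨t % n, Nat.mod_lt _ (NeZero.pos n)⟩ := by
  simp [blobWalk]

theorem blobWalk_odd (t : ℕ) :
    blobWalk n d (2 * t + 1) = .inr ⟨t % d, Nat.mod_lt _ (NeZero.pos d)⟩ := by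
  have h : (2 * t + 1) / 2 = t := by omega
  simp [blobWalk, h]

theorem blobWalk_even_eq_iff {s t : ℕ} :
    blobWalk n d (2 * s) = blobWalk n d (2 * t) ↔ s ≡ t [MOD n] := by
  simp [blobWalk_even, Nat.ModEq]

theorem blobWalk_odd_eq_iff {s t : ℕ} :
    blobWalk n d (2 * s + 1) = blobWalk n d (2 * t + 1) ↔ s ≡ t [MOD d] := by
  simp [blobWalk_odd, Nat.ModEq]

theorem blobWalk_period : blobWalk n d (2 * (n * d)) = blobWalk n d 0 := by
  rw [← mul_zero 2, blobWalk_even_eq_iff]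
  exact (Nat.modEq_zero_iff_dvd).2 (Dvd.intro _ rfl)

theorem blobWalk_surjective (a : Fin n ⊕ Fin d) : ∃ t < 2 * (n * d), blobWalk n d t = a := by
  have hn := NeZero.pos n
  have hd := NeZero.pos d
  rcases a with ⟨a, ha⟩ | ⟨a, ha⟩
  · refine ⟨2 * a, by nlinarith, ?_⟩
    rw [blobWalk_even]
    simp [Nat.mod_eq_of_lt ha]
  · refine ⟨2 * a + 1, by nlinarith, ?_⟩
    rw [blobWalk_odd]
    simp [Nat.mod_eq_of_lt ha]

theorem blobWalk_ne (t : ℕ) : blobWalk n d t ≠ blobWalk n d (t + 1) := by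
  rcases Nat.even_or_odd' t with ⟨s, rfl | rfl⟩
  · simp [blobWalk_even, blobWalk_odd]
  · rw [show 2 * s + 1 + 1 = 2 * (s + 1) by ring, blobWalk_even, blobWalk_odd]
    simp

theorem blobWalk_inj (h : n.Coprime d) {s t : ℕ} (hs : s < 2 * (n * d)) (ht : t < 2 * (n * d))
    (h₁ : blobWalk n d s = blobWalk n d t) (h₂ : blobWalk n d (s + 1) = blobWalk n d (t + 1)) :
    s = t := by
  rcases Nat.even_or_odd' s with ⟨a, rfl | rfl⟩ <;> rcases Nat.even_or_odd' t with ⟨b, rfl | rfl⟩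
  · rw [blobWalk_even_eq_iff] at h₁
    rw [blobWalk_odd_eq_iff] at h₂
    have := ((Nat.modEq_and_modEq_iff_modEq_mul h).1 ⟨h₁, h₂⟩).eq_of_lt_of_lt (by omega) (by omega)
    omega
  · simp [blobWalk_even, blobWalk_odd] at h₁
  · simp [blobWalk_even, blobWalk_odd] at h₁
  · rw [blobWalk_odd_eq_iff] at h₁
    rw [show 2 * a + 1 + 1 = 2 * (a + 1) by ring, show 2 * b + 1 + 1 = 2 * (b + 1) by ring,
      blobWalk_even_eq_iff] at h₂
    have h₂ := Nat.ModEq.add_right_cancel' 1 h₂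
    have := ((Nat.modEq_and_modEq_iff_modEq_mul h).1 ⟨h₂, h₁⟩).eq_of_lt_of_lt (by omega) (by omega)
    omega

theorem blobWalk_symm (h : n.Coprime d) (t : ℕ) : ∃ s < 2 * (n * d),
    blobWalk n d s = blobWalk n d (t + 1) ∧ blobWalk n d (s + 1) = blobWalk n d t := by
  have hn := NeZero.ne n
  have hd := NeZero.ne d
  have key : ∀ a b, ∃ c < n * d, c ≡ a [MOD n] ∧ c ≡ b [MOD d] := fun a b =>
    ⟨Nat.chineseRemainder h a b, Nat.chineseRemainder_lt_mul h a b hn hd,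
      (Nat.chineseRemainder h a b).2⟩
  rcases Nat.even_or_odd' t with ⟨a, rfl | rfl⟩
  · obtain ⟨c, hc, h₁, h₂⟩ := key (a + (n - 1)) a
    refine ⟨2 * c + 1, by omega, blobWalk_odd_eq_iff.2 h₂, ?_⟩
    rw [show 2 * c + 1 + 1 = 2 * (c + 1) by ring, blobWalk_even_eq_iff]
    refine (h₁.add_right 1).trans ?_
    rw [show a + (n - 1) + 1 = a + n by omega]
    exact Nat.add_modEq_right
  · obtain ⟨c, hc, h₁, h₂⟩ := key (a + 1) a
    refine ⟨2 * c, by omega, ?_, blobWalk_odd_eq_iff.2 h₂⟩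
    rw [show 2 * a + 1 + 1 = 2 * (a + 1) by ring, blobWalk_even_eq_iff]
    exact h₁

end Blob

/-- The vertices of two complete bipartite graphs joined by a path. -/
abbrev DumbbellVertex (n d N : ℕ) : Type := Bool × (Fin n ⊕ Fin d) ⊕ Fin (2 * N + 1)

/-- The position along the path of a vertex of the dumbbell. -/
def dumbbellLev {n d N : ℕ} : DumbbellVertex n d N → ℕ
  | .inl (false, _) => 0
  | .inl (true, _) => 2 * N + 2
  | .inr j => j + 1

/-- One round of the Eulerian circuit of the dumbbell, where `e` is the length of a tour of
either blob. -/
def dumbbellRound (n d N e : ℕ) [NeZero n] [NeZero d] (t : ℕ) : DumbbellVertex n d N :=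
  if t ≤ e then .inl (false, blobWalk n d t)
  else if t < e + (2 * N + 2) then .inr ⟨min (t - e - 1) (2 * N), by omega⟩
  else if t ≤ 2 * e + (2 * N + 2) then .inl (true, blobWalk n d (t - (e + (2 * N + 2))))
  else if t < 2 * e + 4 * N + 4 then .inr ⟨min (2 * e + 4 * N + 4 - t - 1) (2 * N), by omega⟩
  else .inl (false, blobWalk n d 0)

/-- The Eulerian circuit of the dumbbell. -/
def dumbbellWalk (n d N e : ℕ) [NeZero n] [NeZero d] (t : ℕ) : DumbbellVertex n d N :=
  dumbbellRound n d N e (t % (2 * e + 4 * N + 4))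

section Round

variable {n d N e : ℕ} [NeZero n] [NeZero d]

theorem dumbbellRound_left {t : ℕ} (h : t ≤ e) :
    dumbbellRound n d N e t = .inl (false, blobWalk n d t) := if_pos h

theorem dumbbellRound_right {t : ℕ} (h : t ≤ e) :
    dumbbellRound n d N e (e + (2 * N + 2) + t) = .inl (true, blobWalk n d t) := by
  rw [dumbbellRound, if_neg (by omega), if_neg (by omega), if_pos (by omega),
    Nat.add_sub_cancel_left]

theorem dumbbellRound_out {j : ℕ} (h : j ≤ 2 * N) :
    dumbbellRound n d N e (e + (j + 1)) = .inr ⟨j, by omega⟩ := by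
  rw [dumbbellRound, if_neg (by omega), if_pos (by omega)]
  congr 2
  omega

theorem dumbbellRound_back {j : ℕ} (h : j ≤ 2 * N) :
    dumbbellRound n d N e (2 * e + 4 * N + 4 - (j + 1)) = .inr ⟨j, by omega⟩ := by
  rw [dumbbellRound, if_neg (by omega), if_neg (by omega), if_neg (by omega), if_pos (by omega)]
  congr 2
  omega

theorem dumbbellRound_len :
    dumbbellRound n d N e (2 * e + 4 * N + 4) = .inl (false, blobWalk n d 0) := by
  rw [dumbbellRound, if_neg (by omega), if_neg (by omega), if_neg (by omega), if_neg (by omega)]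

theorem dumbbellRound_reflect (he : e = 2 * (n * d)) {j : ℕ} (h : j ≤ 2 * N + 2) :
    dumbbellRound n d N e (2 * e + 4 * N + 4 - j) = dumbbellRound n d N e (e + j) := by
  have hp : blobWalk n d e = blobWalk n d 0 := by rw [he, blobWalk_period]
  rcases Nat.eq_zero_or_pos j with rfl | hj
  · rw [Nat.sub_zero, dumbbellRound_len, add_zero, dumbbellRound_left le_rfl, hp]
  rcases h.eq_or_lt with rfl | hj'
  · rw [show 2 * e + 4 * N + 4 - (2 * N + 2) = e + (2 * N + 2) + e by omega,
      dumbbellRound_right le_rfl, hp, ← dumbbellRound_right (Nat.zero_le _), add_zero]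
  · obtain ⟨j, rfl⟩ := Nat.exists_eq_add_of_lt hj
    rw [Nat.zero_add, dumbbellRound_back (by omega), dumbbellRound_out (by omega)]

theorem lev_dumbbellRound (t : ℕ) (ht : t ≤ 2 * e + 4 * N + 4) :
    dumbbellLev (dumbbellRound n d N e t) =
      min (t - e) (min (2 * N + 2) (2 * e + 4 * N + 4 - t)) := by
  rw [dumbbellRound]
  split_ifs <;> simp only [dumbbellLev] <;> omega

theorem dumbbellRound_cases (N e t : ℕ) (ht : t < 2 * e + 4 * N + 4) :
    t < e ∨ (∃ j, j < 2 * N + 2 ∧ t = e + j) ∨ (∃ s, s < e ∧ t = e + (2 * N + 2) + s) ∨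
      ∃ j, j < 2 * N + 2 ∧ t = 2 * e + 4 * N + 4 - (j + 1) := by
  rcases Nat.lt_or_ge t e with h₁ | h₁
  · exact Or.inl h₁
  rcases Nat.lt_or_ge t (e + (2 * N + 2)) with h₂ | h₂
  · exact Or.inr (Or.inl ⟨t - e, by omega, by omega⟩)
  rcases Nat.lt_or_ge t (2 * e + (2 * N + 2)) with h₃ | h₃
  · exact Or.inr (Or.inr (Or.inl ⟨t - (e + (2 * N + 2)), by omega, by omega⟩))
  · exact Or.inr (Or.inr (Or.inr ⟨2 * e + 4 * N + 4 - t - 1, by omega, by omega⟩))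

theorem dumbbellRound_symm (he : e = 2 * (n * d)) (h : n.Coprime d) {t : ℕ}
    (ht : t < 2 * e + 4 * N + 4) : ∃ s < 2 * e + 4 * N + 4,
      dumbbellRound n d N e s = dumbbellRound n d N e (t + 1) ∧
      dumbbellRound n d N e (s + 1) = dumbbellRound n d N e t := by
  rcases dumbbellRound_cases N e t ht with h₁ | ⟨j, hj, rfl⟩ | ⟨t, h₁, rfl⟩ | ⟨j, hj, rfl⟩
  · obtain ⟨s, hs, hs₁, hs₂⟩ := blobWalk_symm h t
    refine ⟨s, by omega, ?_, ?_⟩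
    · rw [dumbbellRound_left (by omega), dumbbellRound_left (by omega), hs₁]
    · rw [dumbbellRound_left (by omega), dumbbellRound_left (by omega), hs₂]
  · refine ⟨2 * e + 4 * N + 4 - (j + 1), by omega, dumbbellRound_reflect he (by omega), ?_⟩
    rw [← dumbbellRound_reflect he (j := j) (by omega)]
    congr 1
    omega
  · obtain ⟨s, hs, hs₁, hs₂⟩ := blobWalk_symm h t
    refine ⟨e + (2 * N + 2) + s, by omega, ?_, ?_⟩
    · rw [dumbbellRound_right (by omega), add_assoc _ t, dumbbellRound_right (by omega), hs₁]
    · rw [add_assoc _ s, dumbbellRound_right (by omega), dumbbellRound_right (by omega), hs₂]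
  · refine ⟨e + j, by omega, ?_, (dumbbellRound_reflect he (j := j + 1) (by omega)).symm⟩
    rw [← dumbbellRound_reflect he (j := j) (by omega)]
    congr 1
    omega

theorem dumbbellRound_ne (he : e = 2 * (n * d)) {t : ℕ} (ht : t < 2 * e + 4 * N + 4) :
    dumbbellRound n d N e t ≠ dumbbellRound n d N e (t + 1) := by
  intro heq
  have hlev := congrArg dumbbellLev heq
  rw [lev_dumbbellRound t ht.le, lev_dumbbellRound (t + 1) (by omega)] at hlev
  rcases dumbbellRound_cases N e t ht with h₁ | ⟨j, hj, rfl⟩ | ⟨t, h₁, rfl⟩ | ⟨j, hj, rfl⟩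
  · rw [dumbbellRound_left (by omega), dumbbellRound_left (by omega)] at heq
    simp [blobWalk_ne] at heq
  · omega
  · rw [dumbbellRound_right (by omega), add_assoc _ t, dumbbellRound_right (by omega)] at heq
    simp [blobWalk_ne] at heq
  · omega

theorem dumbbellRound_inj (he : e = 2 * (n * d)) (h : n.Coprime d) {s t : ℕ}
    (hs : s < 2 * e + 4 * N + 4) (ht : t < 2 * e + 4 * N + 4)
    (h₁ : dumbbellRound n d N e s = dumbbellRound n d N e t)
    (h₂ : dumbbellRound n d N e (s + 1) = dumbbellRound n d N e (t + 1)) : s = t := by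
  have hlev₁ := congrArg dumbbellLev h₁
  have hlev₂ := congrArg dumbbellLev h₂
  rw [lev_dumbbellRound s hs.le, lev_dumbbellRound t ht.le] at hlev₁
  rw [lev_dumbbellRound (s + 1) hs, lev_dumbbellRound (t + 1) ht] at hlev₂
  rcases dumbbellRound_cases N e s hs with hs' | ⟨j, hj, rfl⟩ | ⟨s, hs', rfl⟩ | ⟨j, hj, rfl⟩
  · have ht' : t < e := by omega
    rw [dumbbellRound_left (by omega), dumbbellRound_left (by omega)] at h₁ h₂
    exact blobWalk_inj h (by omega) (by omega) (by simpa using h₁) (by simpa using h₂)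
  · omega
  · obtain ⟨t, rfl⟩ : ∃ t', t = e + (2 * N + 2) + t' := ⟨t - (e + (2 * N + 2)), by omega⟩
    rw [dumbbellRound_right (by omega), dumbbellRound_right (by omega)] at h₁
    rw [add_assoc _ s, add_assoc _ t, dumbbellRound_right (by omega),
      dumbbellRound_right (by omega)] at h₂
    rw [blobWalk_inj h (s := s) (t := t) (by omega) (by omega) (by simpa using h₁)
      (by simpa using h₂)]
  · omega

theorem dumbbellRound_surjective (he : e = 2 * (n * d)) (v : DumbbellVertex n d N) :
    ∃ t < 2 * e + 4 * N + 4, dumbbellRound n d N e t = v := by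
  rcases v with ⟨_ | _, a⟩ | ⟨j, hj⟩
  · obtain ⟨t, ht, rfl⟩ := blobWalk_surjective a
    exact ⟨t, by omega, dumbbellRound_left (by omega)⟩
  · obtain ⟨t, ht, rfl⟩ := blobWalk_surjective a
    exact ⟨e + (2 * N + 2) + t, by omega, dumbbellRound_right (by omega)⟩
  · exact ⟨e + (j + 1), by omega, dumbbellRound_out (by omega)⟩

theorem dumbbellWalk_of_lt {t : ℕ} (ht : t < 2 * e + 4 * N + 4) :
    dumbbellWalk n d N e t = dumbbellRound n d N e t := by
  rw [dumbbellWalk, Nat.mod_eq_of_lt ht]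

theorem dumbbellWalk_of_le {t : ℕ} (ht : t ≤ 2 * e + 4 * N + 4) :
    dumbbellWalk n d N e t = dumbbellRound n d N e t := by
  rcases ht.eq_or_lt with rfl | ht
  · rw [dumbbellWalk, Nat.mod_self, dumbbellRound_len, dumbbellRound_left (Nat.zero_le _)]
  · exact dumbbellWalk_of_lt ht

theorem dumbbellWalk_succ (t : ℕ) : dumbbellWalk n d N e (t + 1) =
    dumbbellRound n d N e (t % (2 * e + 4 * N + 4) + 1) := by
  have h : t % (2 * e + 4 * N + 4) + 1 ≤ 2 * e + 4 * N + 4 := Nat.mod_lt t (by omega)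
  rw [← dumbbellWalk_of_le h, dumbbellWalk, dumbbellWalk, Nat.mod_add_mod]

end Round

/-- The dumbbell: two complete bipartite graphs on `n` and `d` vertices joined by a path with
`2 * N + 2` edges. -/
def dumbbell (n d N e : ℕ) [NeZero n] [NeZero d] : SimpleGraph (DumbbellVertex n d N) :=
  walkGraph (dumbbellWalk n d N e)

noncomputable instance (n d N e : ℕ) [NeZero n] [NeZero d] :
    DecidableRel (dumbbell n d N e).Adj := Classical.decRel _

section Tour

variable {n d N e : ℕ} [NeZero n] [NeZero d]

theorem dumbbell_adj (he : e = 2 * (n * d)) (h : n.Coprime d) {u v : DumbbellVertex n d N} :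
    (dumbbell n d N e).Adj u v ↔ ∃ t < 2 * e + 4 * N + 4,
      dumbbellWalk n d N e t = u ∧ dumbbellWalk n d N e (t + 1) = v := by
  have hmod : ∀ t, t % (2 * e + 4 * N + 4) < 2 * e + 4 * N + 4 := fun t =>
    Nat.mod_lt _ (by omega)
  rw [dumbbell, walkGraph, SimpleGraph.fromRel_adj]
  constructor
  · rintro ⟨-, ⟨t, rfl, rfl⟩ | ⟨t, rfl, rfl⟩⟩
    · refine ⟨t % (2 * e + 4 * N + 4), hmod t, ?_, ?_⟩
      · rw [dumbbellWalk_of_lt (hmod t), dumbbellWalk]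
      · rw [dumbbellWalk_of_le (hmod t), dumbbellWalk_succ]
    · obtain ⟨s, hs, h₁, h₂⟩ := dumbbellRound_symm he h (hmod t)
      refine ⟨s, hs, ?_, ?_⟩
      · rw [dumbbellWalk_of_lt hs, h₁, dumbbellWalk_succ]
      · rw [dumbbellWalk_of_le hs, h₂, dumbbellWalk]
  · rintro ⟨t, ht, rfl, rfl⟩
    refine ⟨?_, Or.inl ⟨t, rfl, rfl⟩⟩
    rw [dumbbellWalk_of_lt ht, dumbbellWalk_of_le ht]
    exact dumbbellRound_ne he ht

theorem dumbbell_adj_walk (he : e = 2 * (n * d)) (h : n.Coprime d) (t : ℕ) :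
    (dumbbell n d N e).Adj (dumbbellWalk n d N e t) (dumbbellWalk n d N e (t + 1)) := by
  have ht : t % (2 * e + 4 * N + 4) < 2 * e + 4 * N + 4 := Nat.mod_lt _ (by omega)
  refine (dumbbell_adj he h).2 ⟨t % (2 * e + 4 * N + 4), ht, ?_, ?_⟩
  · rw [dumbbellWalk_of_lt ht, dumbbellWalk]
  · rw [dumbbellWalk_of_le ht, dumbbellWalk_succ]

theorem dumbbellWalk_surjective (he : e = 2 * (n * d)) (v : DumbbellVertex n d N) :
    ∃ t, dumbbellWalk n d N e t = v := by
  obtain ⟨t, ht, rfl⟩ := dumbbellRound_surjective he v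
  exact ⟨t, dumbbellWalk_of_lt ht⟩

theorem dumbbell_connected (he : e = 2 * (n * d)) (h : n.Coprime d) :
    (dumbbell n d N e).Connected := by
  have hreach : ∀ t, (dumbbell n d N e).Reachable (dumbbellWalk n d N e 0)
      (dumbbellWalk n d N e t) := by
    intro t
    induction t with
    | zero => rfl
    | succ t ih => exact ih.trans (dumbbell_adj_walk he h t).reachable
  refine (SimpleGraph.connected_iff_exists_forall_reachable _).2
    ⟨dumbbellWalk n d N e 0, fun v => ?_⟩
  obtain ⟨t, rfl⟩ := dumbbellWalk_surjective he v
  exact hreach t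

/-- The Eulerian circuit of the dumbbell. -/
noncomputable def dumbbellTour (he : e = 2 * (n * d)) (h : n.Coprime d) :
    LeveledTour (dumbbell n d N e) e N where
  len := 2 * e + 4 * N + 4
  w := dumbbellWalk n d N e
  len_pos := by omega
  periodic t := by rw [dumbbellWalk, Nat.add_mod_right, dumbbellWalk]
  adj := dumbbell_adj_walk he h
  inj s hs t ht h₁ h₂ := by
    rw [dumbbellWalk_of_lt hs, dumbbellWalk_of_lt ht] at h₁
    rw [dumbbellWalk_of_le hs, dumbbellWalk_of_le ht] at h₂
    exact dumbbellRound_inj he h hs ht h₁ h₂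
  surj a := (dumbbell_adj he h).1 a.adj
  lev := dumbbellLev
  len_eq := rfl
  lev_w t ht := by rw [dumbbellWalk_of_le ht, lev_dumbbellRound t ht]
  lev_inj u v h₁ h₂ h₃ := by
    rcases u with ⟨_ | _, _⟩ | u <;> rcases v with ⟨_ | _, _⟩ | v <;>
      simp only [dumbbellLev] at h₁ h₂ h₃ <;> first | omega | exact congrArg _ (Fin.ext (by omega))
  degree_pos v := by
    obtain ⟨t, rfl⟩ := dumbbellWalk_surjective he v
    exact (SimpleGraph.degree_pos_iff_exists_adj _ _).2 ⟨_, dumbbell_adj_walk he h t⟩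

theorem card_dumbbell_edgeFinset (he : e = 2 * (n * d)) (h : n.Coprime d) :
    (dumbbell n d N e).edgeFinset.card = e + 2 * N + 2 := by
  have h₁ := (dumbbellTour (N := N) he h).card_dart
  rw [SimpleGraph.dart_card_eq_twice_card_edges, LeveledTour.len_eq] at h₁
  omega

end Tour

end Dumbbell

section Parameters

theorem exists_coprime_parameters {N M : ℕ} (hN : 8 ≤ N) (hNM : N ≤ M) (hM : M ≤ N ^ 2) :
    ∃ n d : ℕ, 0 < n ∧ 0 < d ∧ n.Coprime d ∧ n + d ≤ 20 * N ∧ 16 * M ≤ n * d ∧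
      n * d ≤ 100 * M := by
  obtain ⟨d, hd⟩ : ∃ d, d = M / N + 1 := ⟨_, rfl⟩
  obtain ⟨q, hq⟩ : ∃ q, q = 16 * N / d + 1 := ⟨_, rfl⟩
  have hd0 : 0 < d := hd ▸ Nat.succ_pos _
  have h₁ : M ≤ N * d := by rw [hd]; exact (Nat.lt_mul_div_succ M (by omega)).le
  have h₂ : N * d ≤ M + N := by
    rw [hd, mul_add, mul_one]
    exact Nat.add_le_add_right (Nat.mul_div_le M N) N
  have h₃ : 16 * N ≤ d * q := by rw [hq]; exact (Nat.lt_mul_div_succ _ hd0).le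
  have h₄ : d * q ≤ 16 * N + d := by
    rw [hq, mul_add, mul_one]
    exact Nat.add_le_add_right (Nat.mul_div_le _ _) d
  have h₅ : d ≤ N + 1 := by
    rw [hd]
    exact Nat.add_le_add_right (Nat.div_le_of_le_mul (by nlinarith)) 1
  refine ⟨d * q + 1, d, by omega, hd0, by simp, by omega, by nlinarith, ?_⟩
  calc (d * q + 1) * d ≤ (16 * N + (N + 1) + 1) * d := Nat.mul_le_mul_right d (by omega)
    _ ≤ 19 * (N * d) := by nlinarith
    _ ≤ 100 * M := by omega

theorem mul_log_le_of_le {N M e s : ℝ} (hN : 8 ≤ N) (hNM : N ≤ M) (he : 32 * M ≤ e)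
    (h : e ^ 2 / 8 * (Real.log (N + 1) - Real.log 2) ≤ e + 4 * N + 2 + s) :
    M ^ 2 * Real.log N ≤ s := by
  have hlog : 1 ≤ Real.log N := by
    rw [Real.le_log_iff_exp_le (by linarith)]
    linarith [Real.exp_one_lt_three]
  have hhalf : Real.log N / 2 ≤ Real.log (N + 1) - Real.log 2 := by
    rw [← Real.log_sqrt (by linarith), ← Real.log_div (by linarith) two_ne_zero]
    refine Real.log_le_log (Real.sqrt_pos.2 (by linarith)) ?_
    rw [Real.sqrt_le_iff]
    exact ⟨by linarith, by nlinarith [sq_nonneg (N - 1)]⟩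
  have h₁ := mul_le_mul_of_nonneg_left hhalf (show 0 ≤ e ^ 2 / 8 by positivity)
  have h₂ : M ^ 2 + (e + 4 * N + 2) ≤ e ^ 2 / 16 := by nlinarith
  have h₃ := mul_le_mul_of_nonneg_right h₂ (zero_le_one.trans hlog)
  have h₄ : e + 4 * N + 2 ≤ (e + 4 * N + 2) * Real.log N :=
    le_mul_of_one_le_right (by linarith) hlog
  linarith

end Parameters

/-- There are constants `c, C > 0` and `N₀` such that for all
`N₀ ≤ N ≤ M ≤ N²` there is a rotor-router system on a finite connected graph with
`Θ(N)` vertices and `Θ(M)` edges, with an initial state carrying exactly `2` tokens,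
whose stabilization time is at least `c·M²·log N`. -/
theorem exists_slow_stabilization :
    ∃ c C : ℝ, 0 < c ∧ 0 < C ∧ ∃ N0 : ℕ, ∀ N M : ℕ, N0 ≤ N → N ≤ M → M ≤ N ^ 2 →
      ∃ (sys : System) (S0 : State sys.G),
        N ≤ Fintype.card sys.V ∧ (Fintype.card sys.V : ℝ) ≤ C * (N : ℝ) ∧
        M ≤ sys.G.edgeFinset.card ∧ (sys.G.edgeFinset.card : ℝ) ≤ C * (M : ℝ) ∧
        (∑ v : sys.V, S0.tokens v) = 2 ∧
        c * (M : ℝ) ^ 2 * Real.log (N : ℝ) ≤ (stabTime sys.G sys.ord S0 : ℝ) := by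
  refine ⟨1, 1000, one_pos, by norm_num, 8, fun N M hN hNM hM => ?_⟩
  obtain ⟨n, d, hn, hd, hnd, hsum, hlow, hupp⟩ := exists_coprime_parameters hN hNM hM
  obtain ⟨e, he⟩ : ∃ e, e = 2 * (n * d) := ⟨_, rfl⟩
  have : NeZero n := ⟨hn.ne'⟩
  have : NeZero d := ⟨hd.ne'⟩
  let T := dumbbellTour (N := N) he hnd
  obtain ⟨ord, hT⟩ := T.exists_follows
  have hcard : Fintype.card (DumbbellVertex n d N) = 2 * (n + d) + (2 * N + 1) := by simp
  have hstab := T.le_stabTime hT (by omega) (by omega) (by omega)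
  refine ⟨⟨DumbbellVertex n d N, dumbbell n d N e, dumbbell_connected he hnd, ord⟩,
    T.toState Config.init, ?_, ?_, ?_, ?_, T.sum_tokens _, ?_⟩
  · show N ≤ Fintype.card (DumbbellVertex n d N)
    omega
  · show (Fintype.card (DumbbellVertex n d N) : ℝ) ≤ _
    have : Fintype.card (DumbbellVertex n d N) ≤ 1000 * N := by omega
    exact_mod_cast this
  · show M ≤ (dumbbell n d N e).edgeFinset.card
    rw [card_dumbbell_edgeFinset he hnd]
    omega
  · show ((dumbbell n d N e).edgeFinset.card : ℝ) ≤ _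
    have : (dumbbell n d N e).edgeFinset.card ≤ 1000 * M := by
      rw [card_dumbbell_edgeFinset he hnd]
      omega
    exact_mod_cast this
  · rw [one_mul]
    have he' : 32 * M ≤ e := by omega
    exact mul_log_le_of_le (by exact_mod_cast hN) (by exact_mod_cast hNM) (by exact_mod_cast he')
      hstab


end RotorRouter
end

section
/- Let G be a finite connected non-bipartite undirected graph with diameter D. Then for any two arcs e, e' of G⃗, the alternating-path distance satisfies d(e,e') ≤ 4D + 1; moreover, there exists an alternating path with first arc e and last arc e' that contains at most 2D consecutive pairs of arcs sharing their ending vertex and at most 2D + 1 consecutive pairs of arcs sharing their starting vertex. -/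
open Finset

namespace RotorRouter

variable {V : Type} [Fintype V] [DecidableEq V] (G : SimpleGraph V) [DecidableRel G.Adj]

variable (ord : ∀ v : V, Fin (G.degree v) ≃ {d : G.Dart // d.fst = v})

/-- A sequence of arcs `f 0, f 1, …, f len` is an alternating path (of length `len`) if
consecutive arcs alternately share their ending vertex and their starting vertex
(in one of the two possible alternation patterns). -/
def IsAltPath (f : ℕ → G.Dart) (len : ℕ) : Prop :=
  (∀ i < len, if i % 2 = 0 then (f i).snd = (f (i + 1)).snd
    else (f i).fst = (f (i + 1)).fst) ∨
  (∀ i < len, if i % 2 = 0 then (f i).fst = (f (i + 1)).fst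
    else (f i).snd = (f (i + 1)).snd)

/-- The alternating-path distance between two arcs: the least length of an alternating
path having `e` and `e'` as its first and last arcs (`⊤` if there is none). -/
noncomputable def altDist (e e' : G.Dart) : ℕ∞ :=
  sInf {l : ℕ∞ | ∃ (len : ℕ) (f : ℕ → G.Dart),
    l = (len : ℕ∞) ∧ IsAltPath G f len ∧ f 0 = e ∧ f len = e'}

omit [Fintype V] [DecidableRel G.Adj] in
/-- An even walk between the starting vertices of two arcs yields an alternating path
between them whose first pair shares its starting vertex. -/
theorem exists_altPath_of_even_walk {e e' : G.Dart} (p : G.Walk e.fst e'.fst)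
    (hp : Even p.length) :
    ∃ f : ℕ → G.Dart, (∀ i < p.length + 1, if i % 2 = 0 then (f i).fst = (f (i + 1)).fst
      else (f i).snd = (f (i + 1)).snd) ∧ f 0 = e ∧ f (p.length + 1) = e' := by
  have key : ∀ i, ∃ d : G.Dart, (i = 0 → d = e) ∧ (i = p.length + 1 → d = e') ∧
      (1 ≤ i → i ≤ p.length → if i % 2 = 1
        then d.fst = p.getVert (i - 1) ∧ d.snd = p.getVert i
        else d.snd = p.getVert (i - 1) ∧ d.fst = p.getVert i) := by
    intro i
    by_cases h0 : i = 0
    · exact ⟨e, fun _ => rfl, by omega, by omega⟩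
    by_cases h1 : i = p.length + 1
    · exact ⟨e', by omega, fun _ => rfl, by omega⟩
    by_cases hi : i ≤ p.length
    · have hadj : G.Adj (p.getVert (i - 1)) (p.getVert i) := by
        have := p.adj_getVert_succ (i := i - 1) (by omega)
        rwa [Nat.sub_add_cancel (by omega)] at this
      by_cases hodd : i % 2 = 1
      · exact ⟨⟨(_, _), hadj⟩, by omega, by omega, fun _ _ => by simp [hodd]⟩
      · exact ⟨⟨(_, _), hadj.symm⟩, by omega, by omega, fun _ _ => by simp [hodd]⟩
    · exact ⟨e, by omega, by omega, by omega⟩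
  choose f hf0 hfl hf using key
  refine ⟨f, fun i hi => ?_, hf0 0 rfl, hfl _ rfl⟩
  have hfst : i % 2 = 0 → (f i).fst = p.getVert i := by
    intro h
    rcases Nat.eq_zero_or_pos i with rfl | hpos
    · rw [hf0 0 rfl, p.getVert_zero]
    · have := hf i hpos (by omega)
      rw [if_neg (by omega)] at this
      exact this.2
  have hfst' : i % 2 = 0 → (f (i + 1)).fst = p.getVert i := by
    intro h
    by_cases hl : i = p.length
    · rw [hfl (i + 1) (by omega), hl, p.getVert_length]
    · have := hf (i + 1) (by omega) (by omega)
      rw [if_pos (by omega)] at this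
      exact this.1
  split_ifs with h
  · rw [hfst h, hfst' h]
  · rw [Nat.even_iff] at hp
    have h₁ := hf i (by omega) (by omega)
    have h₂ := hf (i + 1) (by omega) (by omega)
    rw [if_pos (by omega)] at h₁
    rw [if_neg (by omega)] at h₂
    rw [h₁.2, h₂.1, Nat.add_sub_cancel]

omit [DecidableEq V] in
/-- In a connected non-bipartite graph, any two vertices are joined by an even walk of
length at most `3 * diam + 1`. -/
theorem exists_even_walk (hconn : G.Connected) (hnb : ¬ G.Colorable 2) (u v : V) :
    ∃ p : G.Walk u v, Even p.length ∧ p.length ≤ 3 * G.diam + 1 := by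
  have := hconn.nonempty
  have hdist (a b : V) : G.dist a b ≤ G.diam :=
    SimpleGraph.dist_le_diam (SimpleGraph.connected_iff_ediam_ne_top.mp hconn)
  have hedge : ∃ a b, G.Adj a b ∧ G.dist u a % 2 = G.dist u b % 2 := by
    by_contra! h
    refine hnb ⟨SimpleGraph.Coloring.mk
      (fun w => (⟨G.dist u w % 2, Nat.mod_lt _ two_pos⟩ : Fin 2)) fun {a b} hab heq => ?_⟩
    exact h a b hab (congrArg Fin.val heq)
  obtain ⟨a, b, hab, hpar⟩ := hedge
  obtain ⟨p, hp⟩ := hconn.exists_walk_length_eq_dist u v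
  obtain ⟨q, hq⟩ := hconn.exists_walk_length_eq_dist u a
  obtain ⟨r, hr⟩ := hconn.exists_walk_length_eq_dist u b
  have hv := hdist u v
  have ha := hdist u a
  have hb := hdist u b
  rcases Nat.even_or_odd p.length with heven | hodd
  · exact ⟨p, heven, by omega⟩
  · refine ⟨(q.append (r.reverse.cons hab)).append p, ?_, ?_⟩
    · rw [Nat.odd_iff] at hodd
      simp only [SimpleGraph.Walk.length_append, SimpleGraph.Walk.length_cons,
        SimpleGraph.Walk.length_reverse, Nat.even_iff]
      omega
    · simp only [SimpleGraph.Walk.length_append, SimpleGraph.Walk.length_cons,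
        SimpleGraph.Walk.length_reverse]
      omega

omit [DecidableEq V] [DecidableRel G.Adj] in
/-- A connected non-bipartite graph has positive diameter. -/
theorem diam_pos (hconn : G.Connected) (hnb : ¬ G.Colorable 2) : 0 < G.diam := by
  have := hconn.nonempty
  by_contra h
  refine hnb ⟨SimpleGraph.Coloring.mk (fun _ => (0 : Fin 2)) fun {a b} hab => ?_⟩
  have hd : G.dist a b ≤ G.diam :=
    SimpleGraph.dist_le_diam (SimpleGraph.connected_iff_ediam_ne_top.mp hconn)
  rw [SimpleGraph.dist_eq_one_iff_adj.mpr hab] at hd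
  omega

omit [Fintype V] [DecidableEq V] [DecidableRel G.Adj] in
/-- An alternating path with a repeated consecutive arc can be shortened. -/
theorem IsAltPath.exists_shorter {f : ℕ → G.Dart} {len i : ℕ} (hf : IsAltPath G f len)
    (hi : i < len) (heq : f i = f (i + 1)) :
    ∃ len' < len, ∃ g : ℕ → G.Dart, IsAltPath G g len' ∧ g 0 = f 0 ∧ g len' = f len := by
  by_cases h0 : i = 0
  · subst h0
    refine ⟨len - 1, by omega, fun j => f (j + 1), ?_, heq.symm, ?_⟩
    · refine hf.symm.imp (fun h j hj => ?_) (fun h j hj => ?_) <;>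
      · have := h (j + 1) (by omega)
        grind
    · simp only [Nat.sub_add_cancel (show 1 ≤ len by omega)]
  by_cases hl : i + 1 = len
  · refine ⟨i, hi, f, ?_, rfl, by rw [heq, hl]⟩
    exact hf.imp (fun h j hj => h j (by omega)) (fun h j hj => h j (by omega))
  refine ⟨len - 2, by omega, fun j => if j < i then f j else f (j + 2), ?_, ?_, ?_⟩
  · refine hf.imp (fun h j hj => ?_) (fun h j hj => ?_) <;>
    · rcases lt_trichotomy (j + 1) i with hlt | heq' | hgt
      · have := h j (by omega)
        simpa only [if_pos hlt, if_pos (show j < i by omega)] using this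
      · subst heq'
        have h₁ := h j (by omega)
        have h₂ := h (j + 2) (by omega)
        have hmod : (j + 2) % 2 = j % 2 := by omega
        rw [← heq, hmod] at h₂
        simp only [lt_irrefl, if_false, if_pos (Nat.lt_succ_self j)]
        split_ifs at h₁ h₂ ⊢ <;> exact h₁.trans h₂
      · have h₂ := h (j + 2) (by omega)
        have hmod : (j + 2) % 2 = j % 2 := by omega
        rw [hmod] at h₂
        simpa only [if_neg (show ¬ j < i by omega), if_neg (show ¬ j + 1 < i by omega)] using h₂
  · simp only [if_pos (Nat.pos_of_ne_zero h0)]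
  · simp only [if_neg (show ¬ len - 2 < i by omega), Nat.sub_add_cancel (show 2 ≤ len by omega)]

theorem card_filter_range_le_of_mod_two {P : ℕ → Prop} [DecidablePred P] {n r : ℕ}
    (h : ∀ i < n, P i → i % 2 = r) : ((range n).filter P).card ≤ (n + 1 - r) / 2 := by
  rw [← card_range ((n + 1 - r) / 2)]
  refine card_le_card_of_injOn (· / 2) (fun i hi => ?_) (fun i hi j hj hij => ?_)
  · simp only [coe_filter, Set.mem_ofPred_eq, mem_range] at hi
    have := h i hi.1 hi.2
    simp only [coe_range, Set.mem_Iio]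
    omega
  · simp only [coe_filter, Set.mem_ofPred_eq, mem_range] at hi hj
    have := h i hi.1 hi.2
    have := h j hj.1 hj.2
    dsimp only at hij
    omega

/-- In a finite connected non-bipartite graph of diameter `D`, any two
arcs are at alternating-path distance at most `4D + 1`; moreover there is an alternating
path between them with at most `2D` consecutive pairs sharing their ending vertex and at
most `2D + 1` consecutive pairs sharing their starting vertex. -/
theorem alt_dist_le_of_nonbipartite (hconn : G.Connected) (hnb : ¬ G.Colorable 2)
    (e e' : G.Dart) :
    altDist G e e' ≤ ((4 * G.diam + 1 : ℕ) : ℕ∞) ∧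
    ∃ (len : ℕ) (f : ℕ → G.Dart), IsAltPath G f len ∧ f 0 = e ∧ f len = e' ∧
      ((Finset.range len).filter (fun i => (f i).snd = (f (i + 1)).snd)).card ≤
        2 * G.diam ∧
      ((Finset.range len).filter (fun i => (f i).fst = (f (i + 1)).fst)).card ≤
        2 * G.diam + 1 := by
  classical
  have hD := diam_pos G hconn hnb
  obtain ⟨p, hpe, hpl⟩ := exists_even_walk G hconn hnb e.fst e'.fst
  obtain ⟨f, hf, hf0, hfl⟩ := exists_altPath_of_even_walk G p hpe
  have hlen : p.length + 1 ≤ 4 * G.diam + 1 := by omega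
  refine ⟨(sInf_le ⟨p.length + 1, f, rfl, Or.inr hf, hf0, hfl⟩ :
    altDist G e e' ≤ _).trans (Nat.cast_le.mpr hlen), ?_⟩
  have hex : ∃ n, ∃ g : ℕ → G.Dart, IsAltPath G g n ∧ g 0 = e ∧ g n = e' :=
    ⟨_, f, Or.inr hf, hf0, hfl⟩
  have hmin : Nat.find hex ≤ p.length + 1 := Nat.find_min' hex ⟨f, Or.inr hf, hf0, hfl⟩
  have hne : ∀ g : ℕ → G.Dart, IsAltPath G g (Nat.find hex) → g 0 = e →
      g (Nat.find hex) = e' → ∀ i < Nat.find hex,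
        (g i).fst = (g (i + 1)).fst → (g i).snd ≠ (g (i + 1)).snd := by
    intro g hg hg0 hgl i hi hfst hsnd
    have heq : g i = g (i + 1) := SimpleGraph.Dart.ext _ _ (Prod.ext hfst hsnd)
    obtain ⟨n, hn, g', hg', hg0', hgl'⟩ := hg.exists_shorter G hi heq
    exact Nat.find_min hex hn ⟨g', hg', hg0'.trans hg0, hgl'.trans hgl⟩
  have hcount : ∀ g : ℕ → G.Dart, (∀ i < Nat.find hex, if i % 2 = 0
      then (g i).fst = (g (i + 1)).fst else (g i).snd = (g (i + 1)).snd) → g 0 = e →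
      g (Nat.find hex) = e' →
      ((range (Nat.find hex)).filter (fun i => (g i).snd = (g (i + 1)).snd)).card ≤
        2 * G.diam ∧
      ((range (Nat.find hex)).filter (fun i => (g i).fst = (g (i + 1)).fst)).card ≤
        2 * G.diam + 1 := by
    intro g hg hg0 hgl
    have hne := hne g (Or.inr hg) hg0 hgl
    refine ⟨(card_filter_range_le_of_mod_two (r := 1) fun i hi hsnd => ?_).trans
      (show (Nat.find hex + 1 - 1) / 2 ≤ _ by omega),
      (card_filter_range_le_of_mod_two (r := 0) fun i hi hfst => ?_).trans
      (show (Nat.find hex + 1 - 0) / 2 ≤ _ by omega)⟩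
    · have := hg i hi
      by_contra h
      rw [if_pos (by omega)] at this
      exact hne i hi this hsnd
    · have := hg i hi
      by_contra h
      rw [if_neg h] at this
      exact hne i hi hfst this
  rcases hmin.eq_or_lt with heq | hlt
  · rw [← heq] at hf hfl
    exact ⟨_, f, Or.inr hf, hf0, hfl, hcount f hf hf0 hfl⟩
  obtain ⟨g, hg, hg0, hgl⟩ := Nat.find_spec hex
  refine ⟨_, g, hg, hg0, hgl, ?_⟩
  rcases hg with hg' | hg'
  · have hne := hne g (Or.inl hg') hg0 hgl
    refine ⟨(card_filter_range_le_of_mod_two (r := 0) fun i hi hsnd => ?_).trans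
      (show (Nat.find hex + 1 - 0) / 2 ≤ _ by omega),
      (card_filter_range_le_of_mod_two (r := 1) fun i hi hfst => ?_).trans
      (show (Nat.find hex + 1 - 1) / 2 ≤ _ by omega)⟩
    · have := hg' i hi
      by_contra h
      rw [if_neg h] at this
      exact hne i hi this hsnd
    · have := hg' i hi
      by_contra h
      rw [if_pos (by omega)] at this
      exact hne i hi hfst this
  · exact hcount g hg' hg0 hgl

end RotorRouter
end

section
/- Let G be a finite connected undirected graph with at least one edge. If G is bipartite, then the arc set E⃗ is partitioned into exactly two balancing sets (equivalence classes of the relation d(e,e') < ∞), namely the two sets of arcs oriented from one side of the bipartition to the other; if G is not bipartite, then all arcs of E⃗ form a single balancing set. -/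
open Finset

namespace RotorRouter

variable {V : Type} [Fintype V] [DecidableEq V] (G : SimpleGraph V) [DecidableRel G.Adj]

variable (ord : ∀ v : V, Fin (G.degree v) ≃ {d : G.Dart // d.fst = v})

section Balancing

variable {V : Type} {G : SimpleGraph V}

/-- Two arcs are joined by an alternating path of even length whose first step shares
the ending vertex. -/
def EvenAltReachable (e e' : G.Dart) : Prop :=
  ∃ (n : ℕ) (f : ℕ → G.Dart), n % 2 = 0 ∧
    (∀ i < n, if i % 2 = 0 then (f i).snd = (f (i + 1)).snd
      else (f i).fst = (f (i + 1)).fst) ∧ f 0 = e ∧ f n = e'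

theorem EvenAltReachable.refl (e : G.Dart) : EvenAltReachable e e :=
  ⟨0, fun _ => e, rfl, fun i hi => absurd hi (Nat.not_lt_zero i), rfl, rfl⟩

theorem EvenAltReachable.extend {e d x d' : G.Dart} (h : EvenAltReachable e d)
    (hs : d.snd = x.snd) (hf : x.fst = d'.fst) : EvenAltReachable e d' := by
  obtain ⟨n, f, hn, hp, h0, hd⟩ := h
  refine ⟨n + 2, fun i => if i ≤ n then f i else if i = n + 1 then x else d',
    by omega, fun i hi => ?_, by simpa using h0, by simp⟩
  rcases (by omega : i < n ∨ i = n ∨ i = n + 1) with h | rfl | rfl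
  · have h1 : i ≤ n := h.le
    have h2 : i + 1 ≤ n := h
    simpa only [h1, h2, if_true] using hp i h
  · simpa [hn, hd] using hs
  · have : (n + 1) % 2 ≠ 0 := by omega
    simpa [this] using hf

theorem EvenAltReachable.of_snd_eq {e d d' : G.Dart} (h : EvenAltReachable e d)
    (hs : d.snd = d'.snd) : EvenAltReachable e d' := h.extend hs rfl

theorem EvenAltReachable.of_fst_eq {e d d' : G.Dart} (h : EvenAltReachable e d)
    (hf : d.fst = d'.fst) : EvenAltReachable e d' := h.extend rfl hf

/-- If all arcs leaving `u` are reachable, so are all arcs entering a neighbour of `u`. -/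
theorem EvenAltReachable.entering_of_leaving {e : G.Dart} {u v : V} (huv : G.Adj u v)
    (h : ∀ d : G.Dart, d.fst = u → EvenAltReachable e d) :
    ∀ d : G.Dart, d.snd = v → EvenAltReachable e d :=
  fun _ hd => (h ⟨(u, v), huv⟩ rfl).of_snd_eq hd.symm

/-- If all arcs entering `u` are reachable, so are all arcs leaving a neighbour of `u`. -/
theorem EvenAltReachable.leaving_of_entering {e : G.Dart} {u v : V} (huv : G.Adj u v)
    (h : ∀ d : G.Dart, d.snd = u → EvenAltReachable e d) :
    ∀ d : G.Dart, d.fst = v → EvenAltReachable e d :=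
  fun _ hd => (h ⟨(v, u), huv.symm⟩ rfl).of_fst_eq hd.symm

theorem forall_of_connected (hconn : G.Connected) {p : V → Prop} {a : V} (ha : p a)
    (hp : ∀ u v, G.Adj u v → p u → p v) (v : V) : p v := by
  obtain ⟨w⟩ := hconn.preconnected a v
  induction w with
  | nil => exact ha
  | cons h _ ih => exact ih (hp _ _ h ha)

theorem evenAltReachable_of_coloring (hconn : G.Connected) {c : V → Bool}
    (hc : ∀ u v : V, G.Adj u v → c u ≠ c v) {e e' : G.Dart} (h : c e.fst = c e'.fst) :
    EvenAltReachable e e' := by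
  refine (forall_of_connected hconn (a := e.fst)
    (p := fun v => (c v = c e.fst → ∀ d : G.Dart, d.fst = v → EvenAltReachable e d) ∧
      (c v ≠ c e.fst → ∀ d : G.Dart, d.snd = v → EvenAltReachable e d))
    ⟨fun _ d hd => (EvenAltReachable.refl e).of_fst_eq hd.symm, fun h => absurd rfl h⟩
    ?_ e'.fst).1 h.symm e' rfl
  rintro u v huv ⟨h1, h2⟩
  have := hc u v huv
  refine ⟨fun hv => EvenAltReachable.leaving_of_entering huv (h2 ?_),
    fun hv => EvenAltReachable.entering_of_leaving huv (h1 ?_)⟩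
  · rwa [← hv]
  · revert this hv
    cases c u <;> cases c v <;> cases c e.fst <;> simp

theorem evenAltReachable_of_not_bipartite (hconn : G.Connected)
    (hnb : ¬ ∃ c : V → Bool, ∀ u v : V, G.Adj u v → c u ≠ c v) (e e' : G.Dart) :
    EvenAltReachable e e' := by
  classical
  let A : V → Prop := fun v => ∀ d : G.Dart, d.fst = v → EvenAltReachable e d
  let B : V → Prop := fun v => ∀ d : G.Dart, d.snd = v → EvenAltReachable e d
  have hAB : ∀ u v, G.Adj u v → A u → B v :=
    fun _ _ h => EvenAltReachable.entering_of_leaving h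
  have hBA : ∀ u v, G.Adj u v → B u → A v :=
    fun _ _ h => EvenAltReachable.leaving_of_entering h
  have hor : ∀ v, A v ∨ B v := forall_of_connected hconn (a := e.fst)
    (Or.inl fun d hd => (EvenAltReachable.refl e).of_fst_eq hd.symm)
    fun u v h => Or.rec (fun hA => Or.inr (hAB u v h hA)) (fun hB => Or.inl (hBA u v h hB))
  by_cases hboth : ∃ v, A v ∧ B v
  · obtain ⟨a, ha⟩ := hboth
    exact (forall_of_connected hconn (p := fun v => A v ∧ B v) ha
      (fun u v h hu => ⟨hBA u v h hu.2, hAB u v h hu.1⟩) e'.fst).1 e' rfl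
  · refine absurd ⟨fun v => decide (A v), fun u v h heq => hboth ?_⟩ hnb
    have hiff : A u ↔ A v := by simpa using heq
    rcases hor u with hA | hB
    · exact ⟨v, hiff.1 hA, hAB u v h hA⟩
    · exact ⟨u, hiff.2 (hBA u v h hB), hB⟩

theorem altDist_lt_top_iff {e e' : G.Dart} :
    altDist G e e' < ⊤ ↔
      ∃ (n : ℕ) (f : ℕ → G.Dart), IsAltPath G f n ∧ f 0 = e ∧ f n = e' := by
  unfold altDist
  rw [sInf_lt_iff]
  constructor
  · rintro ⟨_, ⟨n, f, _, h⟩, _⟩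
    exact ⟨n, f, h⟩
  · rintro ⟨n, f, h⟩
    exact ⟨n, ⟨n, f, rfl, h⟩, ENat.natCast_lt_top n⟩

theorem EvenAltReachable.altDist_lt_top {e e' : G.Dart} (h : EvenAltReachable e e') :
    altDist G e e' < ⊤ := by
  obtain ⟨n, f, _, hp, h⟩ := h
  exact altDist_lt_top_iff.2 ⟨n, f, Or.inl hp, h⟩

theorem color_fst_eq_of_altDist_lt_top {c : V → Bool}
    (hc : ∀ u v : V, G.Adj u v → c u ≠ c v) {e e' : G.Dart} (h : altDist G e e' < ⊤) :
    c e.fst = c e'.fst := by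
  obtain ⟨n, f, hp, rfl, rfl⟩ := altDist_lt_top_iff.1 h
  have hsnd : ∀ d d' : G.Dart, d.snd = d'.snd → c d.fst = c d'.fst := by
    intro d d' hd
    have h1 := hc _ _ d.adj
    have h2 := hc _ _ d'.adj
    rw [hd] at h1
    exact (Bool.eq_not_of_ne h1).trans (Bool.eq_not_of_ne h2).symm
  have hstep : ∀ i < n, c (f i).fst = c (f (i + 1)).fst := by
    intro i hi
    rcases hp with hp | hp <;> have hi := hp i hi <;> split_ifs at hi
    exacts [hsnd _ _ hi, congrArg c hi, congrArg c hi, hsnd _ _ hi]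
  have : ∀ i ≤ n, c (f 0).fst = c (f i).fst := by
    intro i
    induction i with
    | zero => exact fun _ => rfl
    | succ i ih => exact fun hi => (ih (by omega)).trans (hstep i hi)
  exact this n le_rfl

end Balancing

/-- In a finite connected graph with at least one edge: if the graph is
bipartite (witnessed by a proper 2-coloring `c`), the arcs split into exactly two
balancing sets, namely the arcs leaving one side and the arcs leaving the other side
(two arcs are at finite alternating distance iff their tails have the same color, and
both classes are nonempty); if the graph is not bipartite, all arcs form one balancing
set (any two arcs are at finite alternating distance). -/
theorem balancing_sets_classification (hconn : G.Connected)
    (hedge : G.edgeSet.Nonempty) :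
    (∀ c : V → Bool, (∀ u v : V, G.Adj u v → c u ≠ c v) →
      ((∀ e e' : G.Dart, (altDist G e e' < ⊤ ↔ c e.fst = c e'.fst)) ∧
        (∃ e : G.Dart, c e.fst = true) ∧ (∃ e : G.Dart, c e.fst = false))) ∧
    ((¬ ∃ c : V → Bool, ∀ u v : V, G.Adj u v → c u ≠ c v) →
      ∀ e e' : G.Dart, altDist G e e' < ⊤) := by
  refine ⟨fun c hc => ⟨fun e e' => ⟨color_fst_eq_of_altDist_lt_top hc,
    fun h => (evenAltReachable_of_coloring hconn hc h).altDist_lt_top⟩, ?_⟩,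
    fun hnb e e' => (evenAltReachable_of_not_bipartite hconn hnb e e').altDist_lt_top⟩
  obtain ⟨⟨u, v⟩, huv⟩ := hedge
  have huv : G.Adj u v := huv
  have hne := hc u v huv
  cases hu : c u <;> cases hv : c v <;> simp only [hu, hv, ne_eq, not_true_eq_false] at hne
  · exact ⟨⟨⟨(v, u), huv.symm⟩, hv⟩, ⟨⟨(u, v), huv⟩, hu⟩⟩
  · exact ⟨⟨⟨(u, v), huv⟩, hu⟩, ⟨⟨(v, u), huv.symm⟩, hv⟩⟩

end RotorRouter
end

section
/- Let S_T be a rotor-router state admitting a τ-step subcycle decomposition with a valid family of bijections M_v, and let E⃗_1 and E⃗_2 be the directed Eulerian subcycles induced by this decomposition containing arcs e_1 and e_2 respectively. Define c_i = L_{T+i}(e_1) − L_{T+i}(e_2) for 0 ≤ i ≤ τ. If c_i = 0 holds for 2m consecutive values of i in {0, …, τ}, then c_i = 0 for all i ∈ {0, …, τ}. -/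
open Finset

namespace RotorRouter

variable {V : Type} [Fintype V] [DecidableEq V] (G : SimpleGraph V) [DecidableRel G.Adj]

variable (ord : ∀ v : V, Fin (G.degree v) ≃ {d : G.Dart // d.fst = v})

/-- A sequence on `{0, …, τ}` satisfying the recurrence `c (i + p + q) = c (i + p) + c (i + q) - c i`
vanishes as soon as it vanishes on a window of length at least `p + q`. -/
theorem eq_zero_of_recurrence {c : ℕ → ℤ} {p q τ a N : ℕ} (hp : 0 < p) (hq : 0 < q)
    (hpq : p + q ≤ N) (ha : a + N ≤ τ + 1)
    (hc : ∀ i, i + p + q ≤ τ → c (i + p + q) = c (i + p) + c (i + q) - c i)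
    (hzero : ∀ i, a ≤ i → i < a + N → c i = 0) : ∀ i ≤ τ, c i = 0 := by
  have forward : ∀ i, a ≤ i → i ≤ τ → c i = 0 := by
    intro i
    induction i using Nat.strong_induction_on with
    | _ i ih =>
      intro hai hi
      by_cases hiN : i < a + N
      · exact hzero i hai hiN
      · obtain ⟨j, rfl⟩ : ∃ j, i = j + p + q := ⟨i - p - q, by omega⟩
        rw [hc j hi, ih (j + p) (by omega) (by omega) (by omega),
          ih (j + q) (by omega) (by omega) (by omega), ih j (by omega) (by omega) (by omega)]
        rfl
  have backward : ∀ k i, a ≤ i + k → i ≤ τ → c i = 0 := by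
    intro k
    induction k using Nat.strong_induction_on with
    | _ k ih =>
      intro i hk hi
      by_cases hai : a ≤ i
      · exact forward i hai hi
      · have h := hc i (by omega)
        rw [ih (k - p) (by omega) (i + p) (by omega) (by omega),
          ih (k - q) (by omega) (i + q) (by omega) (by omega),
          ih (k - (p + q)) (by omega) (i + p + q) (by omega) (by omega)] at h
        omega
  exact fun i hi => backward a i (by omega) hi

/-- A sequence on `{0, …, τ}` of period `p` vanishes as soon as it vanishes on a window of
length at least `p`. -/
theorem eq_zero_of_periodic {c : ℕ → ℤ} {p τ a N : ℕ} (hp : 0 < p)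
    (hpN : p ≤ N) (ha : a + N ≤ τ + 1) (hc : ∀ i, i + p ≤ τ → c (i + p) = c i)
    (hzero : ∀ i, a ≤ i → i < a + N → c i = 0) : ∀ i ≤ τ, c i = 0 := by
  have forward : ∀ i, a ≤ i → i ≤ τ → c i = 0 := by
    intro i
    induction i using Nat.strong_induction_on with
    | _ i ih =>
      intro hai hi
      by_cases hiN : i < a + N
      · exact hzero i hai hiN
      · obtain ⟨j, rfl⟩ : ∃ j, i = j + p := ⟨i - p, by omega⟩
        rw [hc j hi, ih j (by omega) (by omega) (by omega)]
  have backward : ∀ k i, a ≤ i + k → i ≤ τ → c i = 0 := by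
    intro k
    induction k using Nat.strong_induction_on with
    | _ k ih =>
      intro i hk hi
      by_cases hai : a ≤ i
      · exact forward i hai hi
      · rw [← hc i (by omega), ih (k - p) (by omega) (i + p) (by omega) (by omega)]
  exact fun i hi => backward a i (by omega) hi

theorem card_image_iterate_minimalPeriod {α : Type*} [DecidableEq α] (f : α → α) (x : α) :
    ((range (Function.minimalPeriod f x)).image (fun k => f^[k] x)).card =
      Function.minimalPeriod f x := by
  rw [card_image_of_injOn, card_range]
  simpa using Function.iterate_injOn_Iio_minimalPeriod (f := f) (x := x)

theorem minimalPeriod_le_card {α : Type*} [Fintype α] (f : α → α) (x : α) :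
    Function.minimalPeriod f x ≤ Fintype.card α := by
  classical
  rw [← card_image_iterate_minimalPeriod f x]
  exact card_le_univ _

/-- Points of different minimal periods have disjoint orbits. -/
theorem minimalPeriod_add_le_card {α : Type*} [Fintype α] {f : α → α} {x y : α}
    (hx : x ∈ Function.periodicPts f) (hy : y ∈ Function.periodicPts f)
    (hxy : Function.minimalPeriod f x ≠ Function.minimalPeriod f y) :
    Function.minimalPeriod f x + Function.minimalPeriod f y ≤ Fintype.card α := by
  classical
  rw [← card_image_iterate_minimalPeriod f x, ← card_image_iterate_minimalPeriod f y,
    ← card_union_of_disjoint]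
  · exact card_le_univ _
  · rw [disjoint_left]
    intro z hzx hzy
    obtain ⟨i, -, rfl⟩ := mem_image.mp hzx
    obtain ⟨j, -, hj⟩ := mem_image.mp hzy
    apply hxy
    rw [← Function.minimalPeriod_apply_iterate hx i, ← Function.minimalPeriod_apply_iterate hy j, hj]

/-- Loads are shifted along the subcycles. -/
theorem ValidMapping.load_add_iterate {S0 : State G} {T τ : ℕ} {M : G.Dart → G.Dart}
    (hM : ValidMapping G ord S0 T τ M) (e : G.Dart) {i k : ℕ} (h : i + k ≤ τ) :
    load G ord S0 (T + (i + k)) (M^[k] e) = load G ord S0 (T + i) e := by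
  induction k with
  | zero => rfl
  | succ k ih =>
    rw [← ih (by omega), hM.2.2 (M^[k] e) (T + (i + k)) (by omega) (by omega),
      Function.iterate_succ_apply']
    rfl

theorem ValidMapping.load_add_minimalPeriod {S0 : State G} {T τ : ℕ} {M : G.Dart → G.Dart}
    (hM : ValidMapping G ord S0 T τ M) (e : G.Dart) {i : ℕ}
    (h : i + Function.minimalPeriod M e ≤ τ) :
    load G ord S0 (T + (i + Function.minimalPeriod M e)) e = load G ord S0 (T + i) e := by
  have := hM.load_add_iterate G ord e h
  rwa [Function.iterate_minimalPeriod] at this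

/-- Let `S_T` admit a `τ`-step subcycle decomposition with valid family
of bijections `M`, and let `e₁, e₂` be arcs (lying on the induced Eulerian subcycles).
If `c_i = L_{T+i}(e₁) − L_{T+i}(e₂)` vanishes for `2m` consecutive values of `i` in
`{0, …, τ}`, then it vanishes for all `i ∈ {0, …, τ}`. -/
theorem load_difference_zero_propagates (hconn : G.Connected) (S0 : State G)
    (T τ : ℕ) (M : G.Dart → G.Dart) (hM : ValidMapping G ord S0 T τ M)
    (e1 e2 : G.Dart) (a : ℕ) (ha : a + 2 * G.edgeFinset.card ≤ τ + 1)
    (hzero : ∀ i : ℕ, a ≤ i → i < a + 2 * G.edgeFinset.card →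
      (load G ord S0 (T + i) e1 : ℤ) - (load G ord S0 (T + i) e2 : ℤ) = 0) :
    ∀ i : ℕ, i ≤ τ →
      (load G ord S0 (T + i) e1 : ℤ) - (load G ord S0 (T + i) e2 : ℤ) = 0 := by
  have hper : ∀ e : G.Dart, e ∈ Function.periodicPts M := fun e =>
    hM.1.1.mem_periodicPts e
  have hpos : ∀ e : G.Dart, 0 < Function.minimalPeriod M e := fun e =>
    Function.minimalPeriod_pos_of_mem_periodicPts (hper e)
  have hload := fun e i h => hM.load_add_minimalPeriod G ord (i := i) e h
  have hcard := G.dart_card_eq_twice_card_edges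
  by_cases hpq : Function.minimalPeriod M e1 = Function.minimalPeriod M e2
  · refine eq_zero_of_periodic (hpos e1) (hcard ▸ minimalPeriod_le_card M e1) ha ?_ hzero
    intro i hi
    rw [hload e1 i hi, hpq, hload e2 i (hpq ▸ hi)]
  · refine eq_zero_of_recurrence (hpos e1) (hpos e2)
      (hcard ▸ minimalPeriod_add_le_card (hper e1) (hper e2) hpq) ha ?_ hzero
    intro i hi
    rw [hload e2 _ hi, add_right_comm, hload e1 _ (by omega), hload e1 i (by omega),
      hload e2 i (by omega)]
    ring

end RotorRouter
end
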